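/- Let f be a transcendental self-map of ℂ* and let U be an invariant Baker domain of f (a Fatou component with f(U) ⊆ U and U ⊆ I(f)). Then U contains a simply connected absorbing set; that is, there exists a simply connected set H ⊆ U with f(H) ⊆ H such that for every compact set K ⊆ U there is n ∈ ℕ with fⁿ(K) ⊆ H. -/

import Mathlib

open Complex Topology Filter Set Function OnePoint

noncomputable section

/-- The chordal (spherical) distance on the Riemann sphere, restricted to finite points. -/
def chordalDist (z w : ℂ) : ℝ :=
  ‖z - w‖ / Real.sqrt ((1 + ‖z‖ ^ 2) * (1 + ‖w‖ ^ 2))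

/-- A transcendental self-map of `ℂ* = ℂ \ {0}`: a holomorphic self-map of the punctured
plane with essential singularities at `0` and `∞`; equivalently, on `ℂ*` it has the form
`z ^ m * exp (g z + h z⁻¹)` for some `m : ℤ` and nonconstant entire functions `g, h`. -/
def IsTranscendentalSelfMapCStar (f : ℂ → ℂ) : Prop :=
  ∃ (m : ℤ) (g h : ℂ → ℂ),
    Differentiable ℂ g ∧ Differentiable ℂ h ∧
    (¬ ∃ c : ℂ, ∀ z, g z = c) ∧ (¬ ∃ c : ℂ, ∀ z, h z = c) ∧
    ∀ z : ℂ, z ≠ 0 → f z = z ^ m * Complex.exp (g z + h z⁻¹)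

/-- The escaping set `I(f)` of a self-map of the punctured plane: points whose orbit
accumulates only at `0` and `∞`. -/
def escapingSet (f : ℂ → ℂ) : Set ℂ :=
  {z | z ≠ 0 ∧ ∀ ε : ℝ, 0 < ε → ∃ N : ℕ, ∀ n ≥ N,
    ‖f^[n] z‖ < ε ∨ 1 / ε < ‖f^[n] z‖}

/-- The little escaping set `I_e(f)` with essential itinerary `e` (where `true` stands for the
symbol `∞` and `false` for the symbol `0`). -/
def littleEscapingSet (f : ℂ → ℂ) (e : ℕ → Bool) : Set ℂ :=
  {z | z ∈ escapingSet f ∧ ∃ ℓ k : ℕ, ∀ n : ℕ,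
    (1 < ‖f^[n + ℓ] z‖ ↔ e (n + k) = true)}

/-- The immediate little escaping set `Ĩ_e(f)`. -/
def immediateLittleEscapingSet (f : ℂ → ℂ) (e : ℕ → Bool) : Set ℂ :=
  {z | z ∈ escapingSet f ∧ ∃ ℓ : ℕ, ∀ n : ℕ,
    (1 < ‖f^[n + ℓ] z‖ ↔ e (n + ℓ) = true)}

/-- The Fatou set of a self-map of the punctured plane: points of `ℂ*` with a neighbourhood
(inside `ℂ*`) on which the family of iterates is equicontinuous w.r.t. the chordal metric. -/
def FatouSet (f : ℂ → ℂ) : Set ℂ :=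
  {z | z ≠ 0 ∧ ∃ U : Set ℂ, IsOpen U ∧ z ∈ U ∧ (∀ w ∈ U, w ≠ 0) ∧
    ∀ w ∈ U, ∀ ε : ℝ, 0 < ε → ∃ δ : ℝ, 0 < δ ∧ ∀ w' ∈ U,
      chordalDist w w' < δ → ∀ n : ℕ, chordalDist (f^[n] w) (f^[n] w') < ε}

/-- The Julia set `J(f) = ℂ* \ F(f)`. -/
def JuliaSet (f : ℂ → ℂ) : Set ℂ := {z : ℂ | z ≠ 0} \ FatouSet f

/-- A Fatou component: a connected component of the Fatou set. -/
def IsFatouComponent (f : ℂ → ℂ) (U : Set ℂ) : Prop :=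
  ∃ z ∈ FatouSet f, U = connectedComponentIn (FatouSet f) z

/-- A wandering domain: a Fatou component `U` such that the Fatou components containing the
iterated images `fⁿ(U)` are pairwise distinct. -/
def IsWanderingDomain (f : ℂ → ℂ) (U : Set ℂ) : Prop :=
  IsFatouComponent f U ∧ ∃ V : ℕ → Set ℂ, V 0 = U ∧
    (∀ n, IsFatouComponent f (V n)) ∧
    (∀ n, f '' V n ⊆ V (n + 1)) ∧ Function.Injective V

/-- A set is bounded in `ℂ*` if it lies in some closed annulus `{r ≤ |z| ≤ R}`. -/
def BoundedInCStar (X : Set ℂ) : Prop :=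
  ∃ r R : ℝ, 0 < r ∧ r ≤ R ∧ X ⊆ {z : ℂ | r ≤ ‖z‖ ∧ ‖z‖ ≤ R}

/-- The boundary of a subset of `ℂ*` taken in `ℂ*`. -/
def boundaryInCStar (G : Set ℂ) : Set ℂ := frontier G \ {0}

/-- The set `I(f) ∪ {0, ∞}` regarded as a subset of the Riemann sphere `ℂ̂ = ℂ ∪ {∞}`. -/
def escapingSphere (f : ℂ → ℂ) : Set (OnePoint ℂ) :=
  ((fun z : ℂ => (z : OnePoint ℂ)) '' escapingSet f) ∪ {((0 : ℂ) : OnePoint ℂ), ∞}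

/-- The set `I_e(f) ∪ {0, ∞}` regarded as a subset of the Riemann sphere. -/
def littleEscapingSphere (f : ℂ → ℂ) (e : ℕ → Bool) : Set (OnePoint ℂ) :=
  ((fun z : ℂ => (z : OnePoint ℂ)) '' littleEscapingSet f e) ∪ {((0 : ℂ) : OnePoint ℂ), ∞}

/-- A subset of the sphere has exactly two connected components. -/
def HasExactlyTwoComponents (K : Set (OnePoint ℂ)) : Prop :=
  ∃ x ∈ K, ∃ y ∈ K, connectedComponentIn K x ≠ connectedComponentIn K y ∧
    ∀ z ∈ K, connectedComponentIn K z = connectedComponentIn K x ∨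
      connectedComponentIn K z = connectedComponentIn K y

/-- A domain `U ⊆ ℂ*` is doubly connected if its complement in the Riemann sphere has
exactly two connected components. -/
def DoublyConnected (U : Set ℂ) : Prop :=
  HasExactlyTwoComponents (((fun z : ℂ => (z : OnePoint ℂ)) '' U)ᶜ)

/-- A transcendental entire function. -/
def IsTranscendentalEntire (f : ℂ → ℂ) : Prop :=
  Differentiable ℂ f ∧ ¬ ∃ p : Polynomial ℂ, ∀ z, f z = p.eval z

/-- The Fatou set of an entire function. -/
def FatouSetEntire (f : ℂ → ℂ) : Set ℂ :=
  {z | ∃ U : Set ℂ, IsOpen U ∧ z ∈ U ∧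
    ∀ w ∈ U, ∀ ε : ℝ, 0 < ε → ∃ δ : ℝ, 0 < δ ∧ ∀ w' ∈ U,
      chordalDist w w' < δ → ∀ n : ℕ, chordalDist (f^[n] w) (f^[n] w') < ε}

/-- The Julia set of an entire function. -/
def JuliaSetEntire (f : ℂ → ℂ) : Set ℂ := (FatouSetEntire f)ᶜ

/-- `f` has a finite asymptotic value. -/
def HasFiniteAsymptoticValue (f : ℂ → ℂ) : Prop :=
  ∃ (a : ℂ) (γ : ℝ → ℂ), ContinuousOn γ (Set.Ici (0 : ℝ)) ∧
    Tendsto (fun t => ‖γ t‖) atTop atTop ∧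
    Tendsto (fun t => f (γ t)) atTop (nhds a)

/-- On a connected open set, functions whose derivatives tend to zero locally uniformly and whose
values at one point tend to zero, tend to zero locally uniformly. -/
lemma tendstoLocallyUniformlyOn_zero_of_deriv {ι : Type*} {l : Filter ι} {N : Set ℂ}
    (hN : IsOpen N) (hc : IsPreconnected N) {D D' : ι → ℂ → ℂ}
    (hD : ∀ i, ∀ z ∈ N, HasDerivAt (D i) (D' i z) z)
    (h0 : TendstoLocallyUniformlyOn D' (fun _ => 0) l N) {p : ℂ} (hp : p ∈ N)
    (hDp : Tendsto (fun i => D i p) l (𝓝 0)) :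
    TendstoLocallyUniformlyOn D (fun _ => 0) l N := by
  have key : ∀ x ∈ N, ∃ δ > 0, Metric.closedBall x δ ⊆ N ∧ ∀ y ∈ Metric.closedBall x δ,
      Tendsto (fun i => D i y) l (𝓝 0) →
      TendstoUniformlyOn D (fun _ => 0) l (Metric.closedBall x δ) := by
    intro x hx
    obtain ⟨δ, hδ, hsub⟩ := Metric.nhds_basis_closedBall.mem_iff.1 (hN.mem_nhds hx)
    refine ⟨δ, hδ, hsub, fun y hy hty => ?_⟩
    have hu := (tendstoLocallyUniformlyOn_iff_forall_isCompact hN).1 h0 _ hsub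
      (isCompact_closedBall x δ)
    rw [Metric.tendstoUniformlyOn_iff] at hu ⊢
    intro ε hε
    have h1 := hu (ε / (4 * δ)) (by positivity)
    have h2 := (Metric.tendsto_nhds.1 hty) (ε / 2) (by positivity)
    filter_upwards [h1, h2] with i hi1 hi2 z hz
    have hmv := (convex_closedBall x δ).norm_image_sub_le_of_norm_hasDerivWithin_le
      (f := D i) (f' := D' i) (C := ε / (4 * δ))
      (fun w hw => (hD i w (hsub hw)).hasDerivWithinAt)
      (fun w hw => by simpa using (hi1 w hw).le) hy hz
    have hzy : ‖z - y‖ ≤ 2 * δ := by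
      rw [← dist_eq_norm]
      have := dist_triangle_right z y x
      rw [Metric.mem_closedBall] at hy hz
      linarith
    have : ε / (4 * δ) * ‖z - y‖ ≤ ε / 2 := by
      calc ε / (4 * δ) * ‖z - y‖ ≤ ε / (4 * δ) * (2 * δ) := by gcongr
        _ = ε / 2 := by field_simp; norm_num
    simp only [dist_zero_right, dist_zero_left] at hi2 ⊢
    have := norm_sub_norm_le (D i z) (D i y)
    linarith
  have hS : N ⊆ interior {x | Tendsto (fun i => D i x) l (𝓝 0)} := by
    apply hc.subset_of_closure_inter_subset isOpen_interior
    · refine ⟨p, hp, ?_⟩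
      obtain ⟨δ, hδ, -, h⟩ := key p hp
      rw [mem_interior_iff_mem_nhds]
      filter_upwards [Metric.closedBall_mem_nhds p hδ] with z hz
      exact (h p (Metric.mem_closedBall_self hδ.le) hDp).tendsto_at hz
    · rintro x ⟨hx, hxN⟩
      obtain ⟨δ, hδ, -, h⟩ := key x hxN
      obtain ⟨y, hy1, hy2⟩ := mem_closure_iff_nhds.1 hx _ (Metric.closedBall_mem_nhds x hδ)
      rw [mem_interior_iff_mem_nhds]
      filter_upwards [Metric.closedBall_mem_nhds x hδ] with z hz
      exact (h y hy1 (interior_subset hy2)).tendsto_at hz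
  rw [Metric.tendstoLocallyUniformlyOn_iff]
  intro ε hε x hx
  obtain ⟨δ, hδ, -, h⟩ := key x hx
  refine ⟨_, mem_nhdsWithin_of_mem_nhds (Metric.closedBall_mem_nhds x hδ), ?_⟩
  exact Metric.tendstoUniformlyOn_iff.1 (h x (Metric.mem_closedBall_self hδ.le)
    (interior_subset (hS hx))) ε hε

/-- A locally uniform limit of entire functions on a connected open set has a primitive which is
again a locally uniform limit of entire functions. -/
lemma exists_primitive_of_tendstoLocallyUniformlyOn {O : Set ℂ} (hO : IsOpen O)
    (hc : IsPreconnected O) {P : ℕ → ℂ → ℂ} (hP : ∀ n, Differentiable ℂ (P n)) {u : ℂ → ℂ}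
    (hu : TendstoLocallyUniformlyOn P u atTop O) :
    ∃ (F : ℂ → ℂ) (Φ : ℕ → ℂ → ℂ), (∀ n, Differentiable ℂ (Φ n)) ∧
      TendstoLocallyUniformlyOn Φ F atTop O ∧ ∀ z ∈ O, HasDerivAt F (u z) z := by
  rcases O.eq_empty_or_nonempty with rfl | ⟨p, hp⟩
  · exact ⟨0, fun _ => 0, fun _ => differentiable_const 0, by simp [TendstoLocallyUniformlyOn],
      by simp⟩
  choose Ψ hΨ using fun n => (hP n).isExactOn_univ
  let Φ : ℕ → ℂ → ℂ := fun n z => Ψ n z - Ψ n p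
  have hΦ : ∀ n z, HasDerivAt (Φ n) (P n z) z := fun n z =>
    (hΨ n z (mem_univ z)).sub_const _
  have hD : TendstoLocallyUniformlyOn (fun (i : ℕ × ℕ) z => Φ i.1 z - Φ i.2 z) (fun _ => 0)
      (atTop ×ˢ atTop) O := by
    refine tendstoLocallyUniformlyOn_zero_of_deriv hO hc
      (D' := fun i z => P i.1 z - P i.2 z) (fun i z _ => (hΦ i.1 z).sub (hΦ i.2 z)) ?_ hp ?_
    · rw [Metric.tendstoLocallyUniformlyOn_iff] at hu ⊢
      intro ε hε x hx
      obtain ⟨t, ht, h⟩ := hu (ε / 2) (by positivity) x hx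
      refine ⟨t, ht, ?_⟩
      filter_upwards [h.prod_mk h] with i hi y hy
      have h1 := hi.1 y hy
      have h2 := hi.2 y hy
      rw [dist_zero_left, ← dist_eq_norm]
      have := dist_triangle_left (P i.1 y) (P i.2 y) (u y)
      linarith
    · simp [Φ]
  have hlim : ∀ z ∈ O, ∃ a, Tendsto (fun n => Φ n z) atTop (𝓝 a) := by
    intro z hz
    apply cauchySeq_tendsto_of_complete
    rw [cauchySeq_iff_tendsto, ← prod_atTop_atTop_eq]
    rw [Metric.uniformity_eq_comap_nhds_zero, tendsto_comap_iff]
    have := (hD.tendsto_at hz).norm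
    simpa [Function.comp_def, dist_eq_norm] using this
  choose! F hF using hlim
  have hΦF : TendstoLocallyUniformlyOn Φ F atTop O := by
    rw [Metric.tendstoLocallyUniformlyOn_iff] at hD ⊢
    intro ε hε x hx
    obtain ⟨t, ht, h⟩ := hD (ε / 2) (by positivity) x hx
    refine ⟨t ∩ O, inter_mem ht self_mem_nhdsWithin, ?_⟩
    filter_upwards [h.curry] with n hn y hy
    have hle : dist (F y) (Φ n y) ≤ ε / 2 := by
      refine le_of_tendsto ((hF y hy.2).dist tendsto_const_nhds) ?_
      filter_upwards [hn] with k hk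
      have := hk y hy.1
      rw [dist_zero_left, ← dist_eq_norm, dist_comm] at this
      exact this.le
    linarith
  refine ⟨F, Φ, fun n z => (hΦ n z).differentiableAt, hΦF, fun z hz => ?_⟩
  exact hasDerivAt_of_tendstoLocallyUniformlyOn hO hu
    (Eventually.of_forall fun n z _ => hΦ n z) (fun z hz => hF z hz) hz

/-- A weak form of Bloch's theorem: the image of a disc of radius `r` contains a disc whose radius
is comparable to `r` times the modulus of the derivative at the centre. -/
lemma exists_ball_subset_image_of_deriv {W : Set ℂ} (hW : IsOpen W) {h : ℂ → ℂ}
    (hh : DifferentiableOn ℂ h W) {w : ℂ} {r : ℝ} (hr : 0 < r)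
    (hsub : Metric.closedBall w r ⊆ W) :
    ∃ c : ℂ, Metric.ball c (r * ‖deriv h w‖ / 48) ⊆ h '' Metric.closedBall w r := by
  by_cases h0 : deriv h w = 0
  · exact ⟨0, by simp [h0]⟩
  have hd : DifferentiableOn ℂ (deriv h) W := hh.deriv hW
  have hcont : ContinuousOn (fun z => ‖deriv h z‖ * (r - dist z w)) (Metric.closedBall w r) :=
    ((hd.continuousOn.mono hsub).norm).mul (by fun_prop)
  obtain ⟨a, ha, hmax⟩ := (isCompact_closedBall w r).exists_isMaxOn
    ⟨w, Metric.mem_closedBall_self hr.le⟩ hcont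
  have hM : r * ‖deriv h w‖ ≤ ‖deriv h a‖ * (r - dist a w) := by
    have := hmax (Metric.mem_closedBall_self hr.le)
    simp only [mem_ofPred_eq, dist_self, sub_zero] at this
    linarith
  have hpos : 0 < ‖deriv h a‖ * (r - dist a w) :=
    lt_of_lt_of_le (mul_pos hr (norm_pos_iff.2 h0)) hM
  have hda : 0 < r - dist a w := pos_of_mul_pos_right hpos (norm_nonneg _)
  have hna : 0 < ‖deriv h a‖ := pos_of_mul_pos_left hpos hda.le
  obtain ⟨ρ, hρ⟩ : ∃ ρ, ρ = (r - dist a w) / 2 := ⟨_, rfl⟩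
  have hρ0 : 0 < ρ := by rw [hρ]; positivity
  have hsub1 : Metric.closedBall a ρ ⊆ Metric.closedBall w r :=
    Metric.closedBall_subset_closedBall' (by linarith)
  have hbd : ∀ z ∈ Metric.closedBall a ρ, ‖deriv h z‖ ≤ 2 * ‖deriv h a‖ := by
    intro z hz
    have h1 := hmax (hsub1 hz)
    simp only [mem_ofPred_eq] at h1
    have h2 : ρ ≤ r - dist z w := by
      have := dist_triangle z a w
      rw [Metric.mem_closedBall] at hz
      linarith
    have h3 : ‖deriv h z‖ * ρ ≤ (2 * ‖deriv h a‖) * ρ := by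
      calc ‖deriv h z‖ * ρ ≤ ‖deriv h z‖ * (r - dist z w) := by gcongr
        _ ≤ ‖deriv h a‖ * (r - dist a w) := h1
        _ = _ := by rw [hρ]; ring
    exact le_of_mul_le_mul_right h3 hρ0
  have hlip : ∀ z ∈ Metric.closedBall a (ρ / 6), ‖deriv h z - deriv h a‖ ≤ ‖deriv h a‖ / 2 := by
    intro z hz
    rw [Metric.mem_closedBall] at hz
    have := Complex.dist_le_div_mul_dist_of_mapsTo_ball (f := deriv h) (c := a) (R₁ := ρ)
      (R₂ := 3 * ‖deriv h a‖) (z := z)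
      (hd.mono ((Metric.ball_subset_closedBall.trans hsub1).trans hsub))
      (fun y hy => by
        rw [Metric.mem_closedBall, dist_eq_norm]
        have := hbd y (Metric.ball_subset_closedBall hy)
        have := norm_sub_le (deriv h y) (deriv h a)
        linarith)
      (by rw [Metric.mem_ball]; linarith)
    rw [dist_eq_norm] at this
    refine this.trans ?_
    calc 3 * ‖deriv h a‖ / ρ * dist z a ≤ 3 * ‖deriv h a‖ / ρ * (ρ / 6) := by gcongr
      _ = ‖deriv h a‖ / 2 := by field_simp; norm_num
  have hsub6 : Metric.closedBall a (ρ / 6) ⊆ W :=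
    ((Metric.closedBall_subset_closedBall (by linarith)).trans hsub1).trans hsub
  have hsphere : ∀ z ∈ Metric.sphere a (ρ / 6), ‖deriv h a‖ * ρ / 12 ≤ ‖h z - h a‖ := by
    intro z hz
    have hz' : z ∈ Metric.closedBall a (ρ / 6) := Metric.sphere_subset_closedBall hz
    have hmv := (convex_closedBall a (ρ / 6)).norm_image_sub_le_of_norm_hasDerivWithin_le
      (f := fun y => h y - deriv h a * y) (f' := fun y => deriv h y - deriv h a * 1)
      (C := ‖deriv h a‖ / 2)
      (fun y hy => (((hh.differentiableAt (hW.mem_nhds (hsub6 hy))).hasDerivAt).sub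
        ((hasDerivAt_id y).const_mul _)).hasDerivWithinAt)
      (fun y hy => by simpa using hlip y hy)
      (Metric.mem_closedBall_self (by positivity)) hz'
    rw [mem_sphere_iff_norm] at hz
    rw [hz] at hmv
    have h1 : deriv h a * (z - a) = (h z - h a) -
      ((h z - deriv h a * z) - (h a - deriv h a * a)) := by ring
    have h2 : ‖deriv h a‖ * (ρ / 6) = ‖deriv h a * (z - a)‖ := by rw [norm_mul, hz]
    rw [h1] at h2
    have h3 := norm_sub_le (h z - h a) ((h z - deriv h a * z) - (h a - deriv h a * a))
    linarith
  have hcl : DiffContOnCl ℂ h (Metric.ball a (ρ / 6)) := by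
    apply DifferentiableOn.diffContOnCl
    rw [closure_ball a (by positivity)]
    exact hh.mono hsub6
  have hfreq : ∃ᶠ z in 𝓝 a, h z ≠ h a := by
    intro hcon
    have hcon' : h =ᶠ[𝓝 a] fun _ => h a := by
      filter_upwards [hcon] with z hz using not_not.1 hz
    have := hcon'.deriv_eq
    rw [deriv_const] at this
    simp [this] at hna
  refine ⟨h a, ?_⟩
  have hb := hcl.ball_subset_image_closedBall (by positivity) hsphere hfreq
  refine (Metric.ball_subset_ball ?_).trans (hb.trans (image_mono
    ((Metric.closedBall_subset_closedBall (by linarith)).trans hsub1)))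
  have : ‖deriv h a‖ * (r - dist a w) = 2 * (‖deriv h a‖ * ρ) := by rw [hρ]; ring
  linarith

/-- If `F` is a primitive of the logarithmic derivative of a nonvanishing function `φ` on a
connected open set, then `φ` is a nonzero multiple of `exp ∘ F`. -/
lemma exists_eq_exp_add_const {O : Set ℂ} (hO : IsOpen O) (hc : IsPreconnected O)
    {φ F : ℂ → ℂ} (hφ : DifferentiableOn ℂ φ O) (h0 : ∀ z ∈ O, φ z ≠ 0)
    (hF : ∀ z ∈ O, HasDerivAt F (deriv φ z / φ z) z) :
    ∃ c : ℂ, ∀ z ∈ O, φ z = Complex.exp (F z + c) := by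
  rcases O.eq_empty_or_nonempty with rfl | ⟨p, hp⟩
  · exact ⟨0, by simp⟩
  have hder : ∀ z ∈ O, HasDerivAt (fun z => φ z * Complex.exp (-F z)) 0 z := by
    intro z hz
    have h1 := (hφ.differentiableAt (hO.mem_nhds hz)).hasDerivAt
    have h2 := h1.mul (hF z hz).neg.cexp
    refine h2.congr_deriv ?_
    linear_combination -Complex.exp (-F z) * div_mul_cancel₀ (deriv φ z) (h0 z hz)
  have hconst : ∀ z ∈ O, φ z * Complex.exp (-F z) = φ p * Complex.exp (-F p) := fun z hz =>
    hO.is_const_of_deriv_eq_zero hc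
      (fun z hz => (hder z hz).differentiableAt.differentiableWithinAt)
      (fun z hz => (hder z hz).deriv) hz hp
  refine ⟨Complex.log (φ p * Complex.exp (-F p)), fun z hz => ?_⟩
  rw [Complex.exp_add, Complex.exp_log (mul_ne_zero (h0 p hp) (Complex.exp_ne_zero _)),
    ← hconst z hz, mul_comm, mul_assoc, ← Complex.exp_add]
  simp

lemma exists_log_on_ball {φ : ℂ → ℂ} {w : ℂ} {R : ℝ}
    (hφ : DifferentiableOn ℂ φ (Metric.ball w R)) (h0 : ∀ z ∈ Metric.ball w R, φ z ≠ 0) :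
    ∃ L : ℂ → ℂ, DifferentiableOn ℂ L (Metric.ball w R) ∧
      ∀ z ∈ Metric.ball w R, φ z = Complex.exp (L z) := by
  obtain ⟨F, hF⟩ := ((hφ.deriv Metric.isOpen_ball).div hφ h0).isExactOn_ball
  obtain ⟨c, hc⟩ := exists_eq_exp_add_const Metric.isOpen_ball
    (convex_ball w R).isPreconnected hφ h0 hF
  exact ⟨fun z => F z + c,
    fun z hz => ((hF z hz).differentiableAt.add_const c).differentiableWithinAt, hc⟩

lemma exists_sqrt_on_ball {φ : ℂ → ℂ} {w : ℂ} {R : ℝ}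
    (hφ : DifferentiableOn ℂ φ (Metric.ball w R)) (h0 : ∀ z ∈ Metric.ball w R, φ z ≠ 0) :
    ∃ s : ℂ → ℂ, DifferentiableOn ℂ s (Metric.ball w R) ∧
      ∀ z ∈ Metric.ball w R, s z ^ 2 = φ z := by
  obtain ⟨L, hL, h⟩ := exists_log_on_ball hφ h0
  refine ⟨fun z => Complex.exp (L z / 2), (hL.div_const 2).cexp, fun z hz => ?_⟩
  rw [h z hz, ← Complex.exp_nat_mul]
  congr 1
  push_cast
  ring

/-- The set of points where `cosh ^ 2` takes integer values is a net in the plane. -/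
lemma exists_near_cosh_sq_eq_int (c : ℂ) :
    ∃ M : ℂ, ‖M - c‖ ≤ 5 ∧ ∃ n : ℤ, Complex.cosh M ^ 2 = n := by
  have key : ∀ x : ℝ, 0 ≤ x → ∃ u : ℝ, |u - x| ≤ 1 ∧ ∃ n : ℤ, Real.cosh u ^ 2 = n := by
    intro x hx
    have hc1 : (3 / 2 : ℝ) ≤ Real.cosh 1 := by
      have := Real.quadratic_le_exp_of_nonneg (x := 1) (by norm_num)
      rw [Real.cosh_eq]
      have := Real.one_sub_le_exp_neg 1
      have h4 : (5 / 2 : ℝ) ≤ Real.exp 1 := by linarith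
      have h5 := Real.add_one_le_exp (-1 : ℝ)
      have h6 : (1 / 3 : ℝ) ≤ Real.exp (-1) := by
        rw [Real.exp_neg, one_div]
        exact inv_anti₀ (Real.exp_pos 1) (by linarith [Real.exp_one_lt_d9])
      have := Real.exp_one_gt_d9
      linarith
    have hcx := Real.one_le_cosh x
    have h2 : Real.cosh x * (3 / 2) ≤ Real.cosh (x + 1) := by
      rw [Real.cosh_add]
      have h3 : 0 ≤ Real.sinh x * Real.sinh 1 :=
        mul_nonneg (Real.sinh_nonneg_iff.2 hx) (Real.sinh_nonneg_iff.2 zero_le_one)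
      have h4 : Real.cosh x * (3 / 2) ≤ Real.cosh x * Real.cosh 1 := by gcongr
      linarith
    have h3 : Real.cosh x ^ 2 + 1 ≤ Real.cosh (x + 1) ^ 2 := by nlinarith
    have hivt := intermediate_value_Icc (f := fun u => Real.cosh u ^ 2)
      (show x ≤ x + 1 by linarith) (by fun_prop)
    obtain ⟨u, hu, hun⟩ := hivt ⟨Int.le_ceil (Real.cosh x ^ 2),
      (Int.ceil_lt_add_one _).le.trans h3⟩
    exact ⟨u, by rw [abs_le]; constructor <;> linarith [hu.1, hu.2], _, hun⟩
  have key2 : ∀ x : ℝ, ∃ u : ℝ, |u - x| ≤ 1 ∧ ∃ n : ℤ, Real.cosh u ^ 2 = n := by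
    intro x
    rcases le_total 0 x with hx | hx
    · exact key x hx
    · obtain ⟨u, hu, n, hn⟩ := key (-x) (by linarith)
      refine ⟨-u, ?_, n, by rwa [Real.cosh_neg]⟩
      rw [← abs_neg]
      convert hu using 2
      ring
  obtain ⟨u, hu, n, hn⟩ := key2 c.re
  refine ⟨u + ((⌊c.im / Real.pi⌋ : ℤ) : ℂ) * (Real.pi * I), ?_, n, ?_⟩
  · refine (Complex.norm_le_abs_re_add_abs_im _).trans ?_
    have hre : (u + ((⌊c.im / Real.pi⌋ : ℤ) : ℂ) * (Real.pi * I) - c).re = u - c.re := by simp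
    have him : (u + ((⌊c.im / Real.pi⌋ : ℤ) : ℂ) * (Real.pi * I) - c).im =
      ⌊c.im / Real.pi⌋ * Real.pi - c.im := by simp
    rw [hre, him]
    have h1 := Int.floor_le (c.im / Real.pi)
    have h2 := Int.lt_floor_add_one (c.im / Real.pi)
    rw [le_div_iff₀ Real.pi_pos] at h1
    rw [div_lt_iff₀ Real.pi_pos] at h2
    have h3 : |⌊c.im / Real.pi⌋ * Real.pi - c.im| ≤ 4 := by
      rw [abs_le]
      constructor <;> nlinarith [Real.pi_le_four]
    linarith
  · have h1 : ∀ z : ℂ, Complex.cosh z ^ 2 = (Complex.cosh (2 * z) + 1) / 2 := by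
      intro z
      rw [Complex.cosh_two_mul, Complex.sinh_sq]
      ring
    rw [h1, mul_add, show (2 : ℂ) * ((⌊c.im / Real.pi⌋ : ℤ) * (Real.pi * I)) =
      (⌊c.im / Real.pi⌋ : ℤ) * (2 * Real.pi * I) by ring]
    have h2 : Complex.cosh (2 * u + (⌊c.im / Real.pi⌋ : ℤ) * (2 * Real.pi * I)) =
        Complex.cosh (2 * u) := Complex.cosh_periodic.int_mul _ _
    rw [h2, ← h1]
    exact_mod_cast hn

/-- Growth estimate for a holomorphic function omitting the integers on a disc. -/
lemma norm_deriv_le_of_omits_int {b : ℂ → ℂ} {w : ℂ} {R : ℝ} (hR : 0 < R)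
    (hb : DifferentiableOn ℂ b (Metric.ball w R))
    (hZ : ∀ z ∈ Metric.ball w R, ∀ n : ℤ, b z ≠ n) :
    ‖deriv b w‖ ≤ 600 / R * (2 * ‖b w‖ + 1) := by
  obtain ⟨s, hs, hsb⟩ := exists_sqrt_on_ball hb (fun z hz => by simpa using hZ z hz 0)
  obtain ⟨t, ht, htb⟩ := exists_sqrt_on_ball (φ := fun z => b z - 1) (hb.sub_const 1)
    (fun z hz => sub_ne_zero.2 (by simpa using hZ z hz 1))
  have hst : ∀ z ∈ Metric.ball w R, (s z + t z) * (s z - t z) = 1 := by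
    intro z hz
    have h1 := hsb z hz
    have h2 := htb z hz
    linear_combination h1 - h2
  obtain ⟨M, hM, hMe⟩ := exists_log_on_ball (φ := fun z => s z + t z) (hs.add ht)
    (fun z hz => left_ne_zero_of_mul_eq_one (hst z hz))
  have hcosh : ∀ z ∈ Metric.ball w R, s z = Complex.cosh (M z) := by
    intro z hz
    have h1 := hst z hz
    have h2 := hMe z hz
    have h3 : Complex.exp (-M z) = s z - t z := by
      rw [Complex.exp_neg, ← h2]
      exact inv_eq_of_mul_eq_one_right h1
    rw [Complex.cosh, h3, ← h2]
    ring
  have hsinh : ∀ z ∈ Metric.ball w R, t z = Complex.sinh (M z) := by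
    intro z hz
    have h2 := hMe z hz
    rw [hcosh z hz, ← Complex.cosh_add_sinh] at h2
    exact add_left_cancel h2
  have hw : w ∈ Metric.ball w R := Metric.mem_ball_self hR
  obtain ⟨c, hc⟩ := exists_ball_subset_image_of_deriv Metric.isOpen_ball hM
    (half_pos hR) (Metric.closedBall_subset_ball (half_lt_self hR))
  obtain ⟨M0, hM0, n, hn⟩ := exists_near_cosh_sq_eq_int c
  have hMd : ‖deriv M w‖ ≤ 600 / R := by
    by_contra hcon
    push Not at hcon
    rw [div_lt_iff₀ hR] at hcon
    obtain ⟨z, hz, hzM⟩ := hc (show M0 ∈ Metric.ball c (R / 2 * ‖deriv M w‖ / 48) by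
      rw [Metric.mem_ball, dist_eq_norm]; linarith)
    have hz' := Metric.closedBall_subset_ball (half_lt_self hR) hz
    apply hZ z hz' n
    rw [← hsb z hz', hcosh z hz', hzM, hn]
  have hMw := (hM.differentiableAt (Metric.isOpen_ball.mem_nhds hw)).hasDerivAt
  have hbw : deriv b w = 2 * s w * t w * deriv M w := by
    have h1 : b =ᶠ[𝓝 w] fun z => Complex.cosh (M z) ^ 2 := by
      filter_upwards [Metric.isOpen_ball.mem_nhds hw] with z hz
      rw [← hsb z hz, hcosh z hz]
    rw [h1.deriv_eq, (hMw.ccosh.fun_pow 2).deriv, hcosh w hw, hsinh w hw]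
    push_cast
    ring
  have hs2 : ‖s w‖ ^ 2 = ‖b w‖ := by rw [← norm_pow, hsb w hw]
  have ht2 : ‖t w‖ ^ 2 ≤ ‖b w‖ + 1 := by
    rw [← norm_pow, htb w hw]
    simpa using norm_sub_le (b w) 1
  rw [hbw, norm_mul, norm_mul, norm_mul, mul_comm]
  have : ‖(2 : ℂ)‖ * ‖s w‖ * ‖t w‖ ≤ 2 * ‖b w‖ + 1 := by
    rw [Complex.norm_ofNat]
    nlinarith [sq_nonneg (‖s w‖ - ‖t w‖)]
  gcongr

lemma eq_const_of_isLittleO {g : ℂ → ℂ} (hg : Differentiable ℂ g)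
    (h : ∀ ε > 0, ∃ R₀ : ℝ, ∀ z, R₀ ≤ ‖z‖ → ‖g z‖ ≤ ε * ‖z‖) : ∃ c, ∀ z, g z = c := by
  have hd : ∀ c, deriv g c = 0 := by
    intro c
    rw [← norm_le_zero_iff]
    refine le_of_forall_pos_le_add fun ε hε => ?_
    obtain ⟨R₀, hR₀⟩ := h (ε / 2) (by positivity)
    obtain ⟨R, hR⟩ : ∃ R, R = |R₀| + ‖c‖ + 1 := ⟨_, rfl⟩
    have hRpos : 0 < R := by rw [hR]; positivity
    have := Complex.norm_deriv_le_of_forall_mem_sphere_norm_le (c := c) (f := g) (C := ε * R) hRpos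
      hg.diffContOnCl (fun z hz => ?_)
    · rw [mul_div_cancel_right₀ _ hRpos.ne'] at this
      linarith
    · rw [mem_sphere_iff_norm] at hz
      have h1 : ‖z‖ ≤ ‖z - c‖ + ‖c‖ := by simpa using norm_add_le (z - c) c
      have h2 : ‖z - c‖ ≤ ‖z‖ + ‖c‖ := norm_sub_le z c
      rw [hz] at h1 h2
      have h3 := le_abs_self R₀
      have h4 : ‖z‖ ≤ 2 * R := by linarith [norm_nonneg c, abs_nonneg R₀]
      refine (hR₀ z (by linarith)).trans ?_
      nlinarith
  exact ⟨g 0, fun z => is_const_of_deriv_eq_zero hg hd z 0⟩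

/-- A function of the form `m w + g (exp w) + h (exp (-w))` which has no fixed points modulo
`2πi` in a right half-plane must have `g` constant. -/
lemma eq_const_of_no_fixed_points {G g h : ℂ → ℂ} {m : ℤ} {ρ₀ : ℝ} (hg : Differentiable ℂ g)
    (hh : Differentiable ℂ h)
    (hG : ∀ w, G w = m * w + g (Complex.exp w) + h (Complex.exp (-w)))
    (hfix : ∀ w : ℂ, ρ₀ < w.re → ∀ k : ℤ, G w ≠ w + k * (2 * Real.pi * I)) :
    ∃ c, ∀ z, g z = c := by
  have hGd : Differentiable ℂ G := by
    have : G = fun w => m * w + g (Complex.exp w) + h (Complex.exp (-w)) := funext hG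
    rw [this]
    fun_prop
  obtain ⟨N, hN⟩ : ∃ N : ℕ, (N : ℝ) = 1200 := ⟨1200, by norm_num⟩
  have hN0 : N ≠ 0 := by rintro rfl; norm_num at hN
  let b : ℂ → ℂ := fun w => (G w - w) / (2 * Real.pi * I)
  have hbd : Differentiable ℂ b := (hGd.sub differentiable_id).div_const _
  have hZ : ∀ w : ℂ, ρ₀ < w.re → ∀ k : ℤ, b w ≠ k := by
    intro w hw k hk
    apply hfix w hw k
    rw [div_eq_iff Complex.two_pi_I_ne_zero] at hk
    linear_combination hk
  have hder : ∀ w : ℂ, ρ₀ < w.re → ‖deriv b w‖ ≤ 600 / (w.re - ρ₀) * (2 * ‖b w‖ + 1) := by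
    intro w hw
    refine norm_deriv_le_of_omits_int (by linarith) hbd.differentiableOn fun z hz => hZ z ?_
    rw [Metric.mem_ball, dist_comm, dist_eq_norm] at hz
    have := (le_abs_self _).trans (Complex.abs_re_le_norm (w - z))
    rw [Complex.sub_re] at this
    linarith
  obtain ⟨δ, hδ⟩ := (isCompact_Icc (a := -Real.pi) (b := Real.pi)).exists_bound_of_continuousOn
    (f := fun y : ℝ => b ((ρ₀ + 1 : ℝ) + y * I)) (by have := hbd.continuous; fun_prop)
  have hbbound : ∀ w : ℂ, ρ₀ + 1 ≤ w.re → |w.im| ≤ Real.pi →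
      ‖b w‖ ≤ (δ + 1) * (w.re - ρ₀) ^ N := by
    intro w hw him
    have hline : ∀ τ : ℝ, HasDerivAt (fun τ : ℝ => b ((ρ₀ + Real.exp τ : ℝ) + w.im * I))
        (deriv b ((ρ₀ + Real.exp τ : ℝ) + w.im * I) * (Real.exp τ : ℝ)) τ := by
      intro τ
      have h1 : HasDerivAt (fun τ : ℝ => ((ρ₀ + Real.exp τ : ℝ) : ℂ) + w.im * I)
          ((Real.exp τ : ℝ) : ℂ) τ :=
        (((Real.hasDerivAt_exp τ).const_add ρ₀).ofReal_comp).add_const _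
      exact (hbd _).hasDerivAt.comp τ h1
    have hgr := norm_le_gronwallBound_of_norm_deriv_right_le (a := 0)
      (b := Real.log (w.re - ρ₀)) (δ := δ) (K := 1200) (ε := 600)
      (fun τ _ => (hline τ).continuousAt.continuousWithinAt)
      (fun τ _ => (hline τ).hasDerivWithinAt)
      (by simpa using hδ w.im (abs_le.1 him)) (fun τ _ => by
        have h1 := hder ((ρ₀ + Real.exp τ : ℝ) + w.im * I)
          (by simp [Complex.exp_ofReal_re, Real.exp_pos])
        have h2 : ((((ρ₀ + Real.exp τ : ℝ) : ℂ) + w.im * I).re - ρ₀) = Real.exp τ := by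
          simp [Complex.exp_ofReal_re]
        rw [h2] at h1
        have he := Real.exp_pos τ
        rw [norm_mul, Complex.norm_real, Real.norm_of_nonneg he.le]
        calc _ ≤ 600 / Real.exp τ * (2 * ‖b ((ρ₀ + Real.exp τ : ℝ) + w.im * I)‖ + 1) *
              Real.exp τ := by gcongr
          _ = _ := by field_simp; ring)
      (Real.log (w.re - ρ₀)) ⟨Real.log_nonneg (by linarith), le_rfl⟩
    have hx : 0 < w.re - ρ₀ := by linarith
    have hw' : ((ρ₀ + Real.exp (Real.log (w.re - ρ₀)) : ℝ) : ℂ) + w.im * I = w := by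
      rw [Real.exp_log hx, add_sub_cancel, Complex.re_add_im]
    rw [hw', gronwallBound_of_K_ne_0 (by norm_num), sub_zero] at hgr
    beta_reduce at hgr
    rw [← hN, Real.exp_nat_mul, Real.exp_log hx, hN] at hgr
    have : 0 < (w.re - ρ₀) ^ N := by positivity
    linarith
  have hδ0 : 0 ≤ δ := (norm_nonneg _).trans (hδ 0 (by simp [Real.pi_pos.le]))
  obtain ⟨Ch, hCh⟩ := (isCompact_closedBall (0 : ℂ) (Real.exp (-ρ₀))).exists_bound_of_continuousOn
    hh.continuous.continuousOn
  have hCh0 : 0 ≤ Ch := (norm_nonneg _).trans (hCh 0 (by simp [(Real.exp_pos _).le]))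
  obtain ⟨C, hC0, hC⟩ : ∃ C : ℝ, 0 < C ∧ ∀ w : ℂ, ρ₀ + 1 ≤ w.re → |w.im| ≤ Real.pi →
      ‖g (Complex.exp w)‖ ≤ C * (w.re - ρ₀) ^ N := by
    refine ⟨2 * Real.pi * (δ + 1) + ‖(1 - m : ℂ)‖ * (1 + |ρ₀| + Real.pi) + Ch, by positivity,
      fun w hw him => ?_⟩
    have hy1 : 1 ≤ (w.re - ρ₀) ^ N := one_le_pow₀ (by linarith)
    have hy2 : w.re - ρ₀ ≤ (w.re - ρ₀) ^ N := le_self_pow₀ (by linarith) hN0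
    have e1 : g (Complex.exp w) = b w * (2 * Real.pi * I) + (1 - m) * w -
        h (Complex.exp (-w)) := by
      have : b w * (2 * Real.pi * I) = G w - w := div_mul_cancel₀ _ Complex.two_pi_I_ne_zero
      rw [this, hG w]
      ring
    have h1 := hbbound w hw him
    have h2 : ‖h (Complex.exp (-w))‖ ≤ Ch := hCh _ (by
      rw [mem_closedBall_zero_iff, Complex.norm_exp, Complex.neg_re, Real.exp_le_exp]
      linarith)
    have h3 : ‖w‖ ≤ (1 + |ρ₀| + Real.pi) * (w.re - ρ₀) ^ N := by
      have := Complex.norm_le_abs_re_add_abs_im w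
      have h4 : |w.re| ≤ (w.re - ρ₀) + |ρ₀| := by
        have := abs_add_le (w.re - ρ₀) ρ₀
        rw [sub_add_cancel, abs_of_nonneg (show 0 ≤ w.re - ρ₀ by linarith)] at this
        exact this
      nlinarith [abs_nonneg ρ₀, Real.pi_pos]
    have h2pi : ‖(2 * Real.pi * I : ℂ)‖ = 2 * Real.pi := by
      simp [abs_of_pos Real.pi_pos]
    calc ‖g (Complex.exp w)‖ ≤ ‖b w‖ * (2 * Real.pi) + ‖(1 - m : ℂ)‖ * ‖w‖ + Ch := by
          rw [e1]
          refine (norm_sub_le _ _).trans (add_le_add ((norm_add_le _ _).trans ?_) h2)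
          rw [norm_mul (b w), norm_mul (1 - m : ℂ), h2pi]
      _ ≤ (δ + 1) * (w.re - ρ₀) ^ N * (2 * Real.pi) +
          ‖(1 - m : ℂ)‖ * ((1 + |ρ₀| + Real.pi) * (w.re - ρ₀) ^ N) +
          Ch * (w.re - ρ₀) ^ N := by
        have := Real.pi_pos
        have h5 : Ch ≤ Ch * (w.re - ρ₀) ^ N := le_mul_of_one_le_right hCh0 hy1
        gcongr
      _ = _ := by ring
  refine eq_const_of_isLittleO hg fun ε hε => ?_
  have hlo := (Real.isLittleO_pow_exp_atTop (n := N)).bound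
    (show 0 < ε * Real.exp ρ₀ / C by positivity)
  obtain ⟨Y, hY⟩ := eventually_atTop.1 hlo
  refine ⟨Real.exp (ρ₀ + 1 + |Y|), fun z hz => ?_⟩
  have hz0 : z ≠ 0 := norm_pos_iff.1 ((Real.exp_pos _).trans_le hz)
  have hre : ρ₀ + 1 + |Y| ≤ (Complex.log z).re := by
    rw [Complex.log_re]
    exact (Real.le_log_iff_exp_le (norm_pos_iff.2 hz0)).2 hz
  have h1 := hC (Complex.log z) (by linarith [abs_nonneg Y]) (by
    rw [Complex.log_im]; exact Complex.abs_arg_le_pi z)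
  rw [Complex.exp_log hz0] at h1
  have h2 := hY ((Complex.log z).re - ρ₀) (by linarith [le_abs_self Y])
  rw [Real.norm_of_nonneg (Real.exp_pos _).le, Real.norm_of_nonneg
    (pow_nonneg (by linarith [abs_nonneg Y]) _), Real.exp_sub, Complex.log_re,
    Real.exp_log (norm_pos_iff.2 hz0)] at h2
  refine h1.trans ?_
  calc C * ((Complex.log z).re - ρ₀) ^ N ≤
      C * (ε * Real.exp ρ₀ / C * (‖z‖ / Real.exp ρ₀)) := by
        rw [Complex.log_re]; gcongr
    _ = ε * ‖z‖ := by
        have := Real.exp_pos ρ₀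
        field_simp

/-- `u` can be approximated by entire functions, uniformly on compact subsets of `O`. -/
def EntireApprox (O : Set ℂ) (u : ℂ → ℂ) : Prop :=
  ∀ X ⊆ O, IsCompact X → ∀ ε : ℝ, 0 < ε →
    ∃ E : ℂ → ℂ, Differentiable ℂ E ∧ ∀ z ∈ X, ‖u z - E z‖ < ε

/-- The hull of a set with respect to the entire functions. -/
def entireHull (K : Set ℂ) : Set ℂ :=
  {p | ∀ E : ℂ → ℂ, Differentiable ℂ E → ∀ C : ℝ, (∀ z ∈ K, ‖E z‖ ≤ C) → ‖E p‖ ≤ C}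

/-- `O` contains the entire hulls of its compact subsets. -/
def HullConvex (O : Set ℂ) : Prop := ∀ X ⊆ O, IsCompact X → entireHull X ⊆ O

lemma Differentiable.entireApprox {u : ℂ → ℂ} (hu : Differentiable ℂ u) (O : Set ℂ) :
    EntireApprox O u := fun _ _ _ ε hε => ⟨u, hu, fun z _ => by simpa using hε⟩

lemma entireApprox_of_tendsto {ι : Type*} {l : Filter ι} [l.NeBot] {O : Set ℂ} (hO : IsOpen O)
    {P : ι → ℂ → ℂ} {u : ℂ → ℂ} (hP : ∀ n, EntireApprox O (P n))
    (hu : TendstoLocallyUniformlyOn P u l O) : EntireApprox O u := by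
  intro X hX hXc ε hε
  have h := (tendstoLocallyUniformlyOn_iff_forall_isCompact hO).1 hu X hX hXc
  rw [Metric.tendstoUniformlyOn_iff] at h
  obtain ⟨n, hn⟩ := (h (ε / 2) (by positivity)).exists
  obtain ⟨E, hE, h2⟩ := hP n X hX hXc (ε / 2) (by positivity)
  refine ⟨E, hE, fun z hz => ?_⟩
  have h3 := hn z hz
  rw [dist_eq_norm] at h3
  calc ‖u z - E z‖ ≤ ‖u z - P n z‖ + ‖P n z - E z‖ := norm_sub_le_norm_sub_add_norm_sub _ _ _
    _ < ε := by linarith [h2 z hz]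

lemma EntireApprox.exists_tendsto {O : Set ℂ} (hO : IsOpen O) {u : ℂ → ℂ}
    (hu : EntireApprox O u) : ∃ P : ℕ → ℂ → ℂ, (∀ n, Differentiable ℂ (P n)) ∧
      TendstoLocallyUniformlyOn P u atTop O := by
  have : LocallyCompactSpace O := hO.locallyCompactSpace
  let K : CompactExhaustion O := CompactExhaustion.choice O
  have hK : ∀ n, ∃ E : ℂ → ℂ, Differentiable ℂ E ∧
      ∀ z ∈ ((↑) '' K n : Set ℂ), ‖u z - E z‖ < 1 / ((n : ℝ) + 1) := fun n =>
    hu _ (Subtype.coe_image_subset _ _) ((K.isCompact n).image continuous_subtype_val) _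
      Nat.one_div_pos_of_nat
  choose P hP h using hK
  refine ⟨P, hP, ?_⟩
  rw [tendstoLocallyUniformlyOn_iff_forall_isCompact hO]
  intro X hX hXc
  obtain ⟨N, hN⟩ := K.exists_superset_of_isCompact
    (Subtype.isCompact_iff.2 (by rwa [Subtype.image_preimage_coe, inter_eq_self_of_subset_right hX])
      : IsCompact ((↑) ⁻¹' X : Set O))
  rw [Metric.tendstoUniformlyOn_iff]
  intro ε hε
  have h1 := (tendsto_one_div_add_atTop_nhds_zero_nat (𝕜 := ℝ)).eventually_lt_const hε
  filter_upwards [h1, eventually_ge_atTop N] with n hn hNn z hz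
  rw [dist_eq_norm]
  exact (h n z ⟨⟨z, hX hz⟩, K.subset hNn (hN hz), rfl⟩).trans hn

lemma EntireApprox.differentiableOn {O : Set ℂ} (hO : IsOpen O) {u : ℂ → ℂ}
    (hu : EntireApprox O u) : DifferentiableOn ℂ u O := by
  obtain ⟨P, hP, h⟩ := hu.exists_tendsto hO
  exact h.differentiableOn (Eventually.of_forall fun n => (hP n).differentiableOn) hO

lemma EntireApprox.mul {O : Set ℂ} (hO : IsOpen O) {u v : ℂ → ℂ}
    (hu : EntireApprox O u) (hv : EntireApprox O v) : EntireApprox O (fun z => u z * v z) := by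
  obtain ⟨P, hP, h⟩ := hu.exists_tendsto hO
  obtain ⟨Q, hQ, h'⟩ := hv.exists_tendsto hO
  exact entireApprox_of_tendsto hO (fun n => ((hP n).mul (hQ n)).entireApprox O)
    (h.mul₀ h' (hu.differentiableOn hO).continuousOn (hv.differentiableOn hO).continuousOn)

lemma EntireApprox.comp {O : Set ℂ} {u : ℂ → ℂ} (hO : IsOpen O)
    (hu : EntireApprox O u) {φ : ℂ → ℂ} (hφ : Differentiable ℂ φ) :
    EntireApprox O (fun z => φ (u z)) := by
  intro X hX hXc ε hε
  have hcpt : IsCompact (u '' X) :=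
    hXc.image_of_continuousOn ((hu.differentiableOn hO).continuousOn.mono hX)
  have hc := hcpt.cthickening (r := 1)
  obtain ⟨δ, hδ, h⟩ := Metric.uniformContinuousOn_iff.1
    (hc.uniformContinuousOn_of_continuous hφ.continuous.continuousOn) ε hε
  obtain ⟨E, hE, h1⟩ := hu X hX hXc (min 1 δ) (by positivity)
  refine ⟨fun z => φ (E z), hφ.comp hE, fun z hz => ?_⟩
  rw [← dist_eq_norm]
  have h2 := h1 z hz
  rw [← dist_eq_norm] at h2
  refine h _ (Metric.self_subset_cthickening _ (mem_image_of_mem u hz)) _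
    (Metric.mem_cthickening_of_dist_le _ (u z) _ _ (mem_image_of_mem u hz) ?_)
    (h2.trans_le (min_le_right _ _))
  rw [dist_comm]
  exact (h2.trans_le (min_le_left _ _)).le

lemma EntireApprox.deriv {O : Set ℂ} (hO : IsOpen O) {u : ℂ → ℂ}
    (hu : EntireApprox O u) : EntireApprox O (deriv u) := by
  obtain ⟨P, hP, h⟩ := hu.exists_tendsto hO
  exact entireApprox_of_tendsto hO
    (fun n => ((hP n).deriv).entireApprox O)
    (h.deriv (Eventually.of_forall fun n => (hP n).differentiableOn) hO)

/-- The algebra of restrictions of entire functions. -/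
def entireSubalgebra (X : Set ℂ) : Subalgebra ℂ C(X, ℂ) where
  carrier := {f | ∃ E : ℂ → ℂ, Differentiable ℂ E ∧ ∀ x : X, f x = E x}
  mul_mem' := by
    rintro f g ⟨E, hE, h⟩ ⟨F, hF, h'⟩
    exact ⟨fun z => E z * F z, hE.mul hF, fun x => by simp [h, h']⟩
  add_mem' := by
    rintro f g ⟨E, hE, h⟩ ⟨F, hF, h'⟩
    exact ⟨fun z => E z + F z, hE.add hF, fun x => by simp [h, h']⟩
  algebraMap_mem' c := ⟨fun _ => c, differentiable_const c, fun x => by simp⟩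

lemma norm_character_le {X : Set ℂ} [CompactSpace X]
    (χ : (entireSubalgebra X).topologicalClosure →ₐ[ℂ] ℂ)
    (f : (entireSubalgebra X).topologicalClosure) : ‖χ f‖ ≤ ‖(f : C(X, ℂ))‖ := by
  have hcs : CompleteSpace (entireSubalgebra X).topologicalClosure :=
    (Subalgebra.isClosed_topologicalClosure _).completeSpace_coe
  have h1 : ‖(1 : (entireSubalgebra X).topologicalClosure)‖ ≤ 1 := by
    change ‖(1 : C(X, ℂ))‖ ≤ 1
    exact (ContinuousMap.norm_le _ zero_le_one).2 fun x => by simp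
  calc ‖χ f‖ ≤ ‖f‖ * ‖(1 : (entireSubalgebra X).topologicalClosure)‖ :=
        AlgHom.norm_apply_le_self_mul_norm_one χ f
    _ ≤ ‖f‖ * 1 := by gcongr
    _ = ‖(f : C(X, ℂ))‖ := by rw [mul_one]; rfl

/-- The characters of the uniform closure of the entire functions on `X` are evaluations at points
of the entire hull. -/
lemma exists_mem_entireHull_of_character {X : Set ℂ} [CompactSpace X]
    (χ : (entireSubalgebra X).topologicalClosure →ₐ[ℂ] ℂ) :
    ∃ p ∈ entireHull X, ∀ (E : ℂ → ℂ), Differentiable ℂ E →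
      ∀ f : (entireSubalgebra X).topologicalClosure, (∀ x : X, (f : C(X, ℂ)) x = E x) →
        χ f = E p := by
  have hcs : CompleteSpace (entireSubalgebra X).topologicalClosure :=
    (Subalgebra.isClosed_topologicalClosure _).completeSpace_coe
  have hlift : ∀ E : ℂ → ℂ, Differentiable ℂ E →
      ∃ f : (entireSubalgebra X).topologicalClosure, ∀ x : X, (f : C(X, ℂ)) x = E x :=
    fun E hE => ⟨⟨⟨fun x => E x, by have := hE.continuous; fun_prop⟩,
      Subalgebra.le_topologicalClosure _ ⟨E, hE, fun _ => rfl⟩⟩, fun _ => rfl⟩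
  obtain ⟨ζ, hζ⟩ := hlift id differentiable_id
  have heval : ∀ (E : ℂ → ℂ), Differentiable ℂ E →
      ∀ f : (entireSubalgebra X).topologicalClosure, (∀ x : X, (f : C(X, ℂ)) x = E x) →
        χ f = E (χ ζ) := by
    intro E hE f hf
    obtain ⟨d, hd⟩ := hlift (dslope E (χ ζ))
      (fun z => ((Complex.differentiableOn_dslope (s := univ) univ_mem).2
        hE.differentiableOn).differentiableAt univ_mem)
    have h1 : f - algebraMap ℂ _ (E (χ ζ)) = (ζ - algebraMap ℂ _ (χ ζ)) * d := by
      ext x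
      have := sub_smul_dslope E (χ ζ) x
      simp only [smul_eq_mul] at this
      simp [hf, hd, hζ, this]
    have h2 := congrArg χ h1
    simp only [map_sub, map_mul, AlgHom.commutes, Algebra.algebraMap_self, RingHom.id_apply,
      sub_self, zero_mul] at h2
    exact sub_eq_zero.1 h2
  refine ⟨χ ζ, fun E hE C hC => ?_, heval⟩
  rcases isEmpty_or_nonempty X with hX | hX
  · have h0 : (1 : (entireSubalgebra X).topologicalClosure) = 0 := by
      ext x
      exact hX.elim x
    have := congrArg χ h0
    simp at this
  · obtain ⟨f, hf⟩ := hlift E hE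
    rw [← heval E hE f hf]
    refine (norm_character_le χ f).trans ?_
    exact (ContinuousMap.norm_le_of_nonempty (f : C(X, ℂ))).2 fun x => by
      rw [hf x]; exact hC x x.2

lemma EntireApprox.inv {O : Set ℂ} (hO : IsOpen O) (hconv : HullConvex O) {u : ℂ → ℂ}
    (hu : EntireApprox O u) (h0 : ∀ z ∈ O, u z ≠ 0) : EntireApprox O (fun z => (u z)⁻¹) := by
  intro X hX hXc ε hε
  have : CompactSpace X := isCompact_iff_compactSpace.1 hXc
  have hcs : CompleteSpace (entireSubalgebra X).topologicalClosure :=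
    (Subalgebra.isClosed_topologicalClosure _).completeSpace_coe
  have huc : Continuous fun x : X => u x :=
    continuousOn_iff_continuous_domRestrict.1 ((hu.differentiableOn hO).continuousOn.mono hX)
  have hmem : (⟨fun x : X => u x, huc⟩ : C(X, ℂ)) ∈ (entireSubalgebra X).topologicalClosure := by
    rw [← SetLike.mem_coe, Subalgebra.topologicalClosure_coe, Metric.mem_closure_iff]
    intro δ hδ
    obtain ⟨E, hE, h⟩ := hu X hX hXc δ hδ
    refine ⟨⟨fun x => E x, by have := hE.continuous; fun_prop⟩, ⟨E, hE, fun _ => rfl⟩, ?_⟩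
    rw [ContinuousMap.dist_lt_iff hδ]
    intro x
    rw [dist_eq_norm]
    exact h x x.2
  have hunit : IsUnit (⟨_, hmem⟩ : (entireSubalgebra X).topologicalClosure) := by
    by_contra hcon
    obtain ⟨χ, hχ⟩ := WeakDual.CharacterSpace.exists_apply_eq_zero hcon
    obtain ⟨p, hp, hev⟩ := exists_mem_entireHull_of_character
      (WeakDual.CharacterSpace.toAlgHom χ)
    have hpO := hconv X hX hXc hp
    have hup : 0 < ‖u p‖ := norm_pos_iff.2 (h0 p hpO)
    obtain ⟨E, hE, h⟩ := hu (insert p X) (insert_subset hpO hX) (hXc.insert p) (‖u p‖ / 2)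
      (by positivity)
    let e : (entireSubalgebra X).topologicalClosure :=
      ⟨⟨fun x => E x, by have := hE.continuous; fun_prop⟩,
        Subalgebra.le_topologicalClosure _ ⟨E, hE, fun _ => rfl⟩⟩
    have h1 := norm_character_le (WeakDual.CharacterSpace.toAlgHom χ) (⟨_, hmem⟩ - e)
    rw [map_sub, hev E hE e fun _ => rfl] at h1
    have h2 : WeakDual.CharacterSpace.toAlgHom χ ⟨_, hmem⟩ = 0 := hχ
    rw [h2, zero_sub, norm_neg] at h1
    have h3 : ‖((⟨_, hmem⟩ - e : (entireSubalgebra X).topologicalClosure) : C(X, ℂ))‖ ≤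
        ‖u p‖ / 2 :=
      (ContinuousMap.norm_le _ (by positivity)).2 fun x => (h x (mem_insert_of_mem p x.2)).le
    have h4 := h p (mem_insert p X)
    have h5 := norm_sub_norm_le (u p) (E p)
    linarith
  obtain ⟨v, hv⟩ := hunit.exists_right_inv
  have hvx : ∀ x : X, (v : C(X, ℂ)) x = (u x)⁻¹ := by
    intro x
    have h1 := congrArg (fun a : (entireSubalgebra X).topologicalClosure => (a : C(X, ℂ)) x) hv
    exact eq_inv_of_mul_eq_one_right h1
  have hvm := v.2
  rw [← SetLike.mem_coe, Subalgebra.topologicalClosure_coe, Metric.mem_closure_iff] at hvm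
  obtain ⟨f, ⟨E, hE, hf⟩, hlt⟩ := hvm ε hε
  refine ⟨E, hE, fun z hz => ?_⟩
  have := (ContinuousMap.dist_lt_iff hε).1 hlt ⟨z, hz⟩
  rw [hvx ⟨z, hz⟩, hf ⟨z, hz⟩, dist_eq_norm] at this
  exact this

lemma EntireApprox.exists_log {O : Set ℂ} (hO : IsOpen O) (hc : IsPreconnected O)
    (hconv : HullConvex O) {u : ℂ → ℂ} (hu : EntireApprox O u) (h0 : ∀ z ∈ O, u z ≠ 0) :
    ∃ L : ℂ → ℂ, EntireApprox O L ∧ ∀ z ∈ O, u z = Complex.exp (L z) := by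
  obtain ⟨P, hP, h⟩ := ((hu.deriv hO).mul hO (hu.inv hO hconv h0)).exists_tendsto hO
  obtain ⟨F, Φ, hΦ, hΦF, hF⟩ := exists_primitive_of_tendstoLocallyUniformlyOn hO hc hP h
  obtain ⟨c, hcF⟩ := exists_eq_exp_add_const hO hc (hu.differentiableOn hO) h0 hF
  exact ⟨fun z => F z + c, (entireApprox_of_tendsto hO (fun n => (hΦ n).entireApprox O) hΦF).comp
    hO (φ := fun z => z + c) (by fun_prop), hcF⟩

lemma EntireApprox.exists_sqrt {O : Set ℂ} (hO : IsOpen O) (hc : IsPreconnected O)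
    (hconv : HullConvex O) {u : ℂ → ℂ} (hu : EntireApprox O u) (h0 : ∀ z ∈ O, u z ≠ 0) :
    ∃ s : ℂ → ℂ, EntireApprox O s ∧ ∀ z ∈ O, s z ^ 2 = u z := by
  obtain ⟨L, hL, h⟩ := hu.exists_log hO hc hconv h0
  refine ⟨fun z => Complex.exp (L z / 2), hL.comp hO (φ := fun z => Complex.exp (z / 2))
    (by fun_prop), fun z hz => ?_⟩
  rw [h z hz, ← Complex.exp_nat_mul]
  congr 1
  push_cast
  ring

lemma isClosed_entireHull (K : Set ℂ) : IsClosed (entireHull K) := by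
  have : entireHull K = ⋂ (E : ℂ → ℂ) (_ : Differentiable ℂ E) (C : ℝ)
      (_ : ∀ z ∈ K, ‖E z‖ ≤ C), {p | ‖E p‖ ≤ C} := by
    ext p
    simp [entireHull]
  rw [this]
  refine isClosed_iInter fun E => isClosed_iInter fun hE => isClosed_iInter fun C =>
    isClosed_iInter fun _ => isClosed_le hE.continuous.norm continuous_const

/-- The frontier of the entire hull of a compact set lies in that set. -/
lemma frontier_entireHull_subset {K : Set ℂ} (hK : IsCompact K) :
    frontier (entireHull K) ⊆ K := by
  intro p hp
  have hpH : p ∈ entireHull K := (isClosed_entireHull K).frontier_subset hp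
  by_contra hpK
  rcases K.eq_empty_or_nonempty with rfl | hne
  · have := hpH (fun _ => 1) (differentiable_const _) 0 (by simp)
    simp at this
    linarith
  obtain ⟨d, hd, hball⟩ := Metric.nhds_basis_ball.mem_iff.1 (hK.isClosed.isOpen_compl.mem_nhds hpK)
  rw [frontier_eq_closure_inter_closure] at hp
  obtain ⟨ζ, hζd, hζ⟩ := mem_closure_iff_nhds.1 hp.2 _
    (Metric.ball_mem_nhds p (show 0 < d / 6 by positivity))
  obtain ⟨E, hE, C, hC, hlt⟩ : ∃ E : ℂ → ℂ, Differentiable ℂ E ∧ ∃ C : ℝ,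
      (∀ z ∈ K, ‖E z‖ ≤ C) ∧ C < ‖E ζ‖ := by
    simp only [entireHull, mem_compl_iff, mem_ofPred_eq] at hζ
    push Not at hζ
    obtain ⟨E, hE, C, hC, h⟩ := hζ
    exact ⟨E, hE, C, hC, h⟩
  have hC0 : 0 ≤ C := (norm_nonneg _).trans (hC _ hne.some_mem)
  have hEζ : 0 < ‖E ζ‖ := hC0.trans_lt hlt
  obtain ⟨n, hn⟩ := exists_pow_lt_of_lt_one (show (0 : ℝ) < 1 / 3 by norm_num)
    ((div_lt_one hEζ).2 hlt)
  let Q : ℂ → ℂ := fun z => (E z / E ζ) ^ n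
  have hQ : Differentiable ℂ Q := (hE.div_const _).pow n
  have hQζ : Q ζ = 1 := by simp [Q, div_self (norm_pos_iff.1 hEζ)]
  have hQK : ∀ z ∈ K, ‖Q z‖ ≤ 1 / 3 := by
    intro z hz
    simp only [Q, norm_pow, norm_div]
    refine le_trans ?_ hn.le
    gcongr
    exact hC z hz
  have hQp : ‖Q p‖ ≤ 1 / 3 := hpH Q hQ _ hQK
  have hds : Differentiable ℂ (dslope Q ζ) := fun z =>
    ((Complex.differentiableOn_dslope (s := univ) univ_mem).2
      hQ.differentiableOn).differentiableAt univ_mem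
  have hdist : dist p ζ < d / 6 := by rw [dist_comm]; exact hζd
  have key : ∀ z ∈ K, ‖dslope Q ζ z‖ ≤ (4 / 3) / (5 / 6 * d) := by
    intro z hz
    have h1 : d ≤ dist z p := by
      by_contra hcon
      exact hball (Metric.mem_ball.2 (not_le.1 hcon)) hz
    have h2 : 5 / 6 * d ≤ ‖z - ζ‖ := by
      rw [← dist_eq_norm]
      have := dist_triangle_right z p ζ
      have := dist_triangle z ζ p
      rw [dist_comm ζ p] at this
      linarith
    have h3 := congrArg norm (sub_smul_dslope Q ζ z)
    rw [norm_smul, hQζ] at h3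
    have h4 := norm_sub_le (Q z) 1
    rw [norm_one] at h4
    rw [le_div_iff₀ (by positivity)]
    have h5 := hQK z hz
    nlinarith [norm_nonneg (dslope Q ζ z)]
  have h6 := hpH _ hds _ key
  have h3 := congrArg norm (sub_smul_dslope Q ζ p)
  rw [norm_smul, hQζ] at h3
  have h4 := norm_sub_norm_le 1 (Q p)
  rw [norm_one, norm_sub_rev] at h4
  rw [dist_eq_norm] at hdist
  have h7 : ‖p - ζ‖ * ‖dslope Q ζ p‖ ≤ (d / 6) * ((4 / 3) / (5 / 6 * d)) := by
    gcongr
  have h8 : (d / 6) * ((4 / 3) / (5 / 6 * d)) = 4 / 15 := by field_simp; norm_num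
  linarith

/-- A connected component of a hull convex proper open set is hull convex. -/
lemma HullConvex.connectedComponentIn {A : Set ℂ} (hA : IsOpen A) (hne : A ≠ univ)
    (hconv : HullConvex A) (w : ℂ) : HullConvex (connectedComponentIn A w) := by
  intro X hX hXc p hp
  have hXA : X ⊆ A := hX.trans (connectedComponentIn_subset A w)
  have hpA := hconv X hXA hXc hp
  by_contra hpw
  have hO : IsOpen (_root_.connectedComponentIn A p) := hA.connectedComponentIn
  have hint : ∀ x ∈ entireHull X, x ∈ _root_.connectedComponentIn A p →
      x ∈ interior (entireHull X) := by
    intro x hx hxp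
    by_contra hcon
    have h1 : x ∈ _root_.connectedComponentIn A w := hX (frontier_entireHull_subset hXc
      ⟨subset_closure hx, hcon⟩)
    rw [connectedComponentIn_eq h1, ← connectedComponentIn_eq hxp] at hpw
    exact hpw (mem_connectedComponentIn hpA)
  have hsub : _root_.connectedComponentIn A p ⊆ interior (entireHull X) := by
    apply isPreconnected_connectedComponentIn.subset_of_closure_inter_subset isOpen_interior
    · exact ⟨p, mem_connectedComponentIn hpA, hint p hp (mem_connectedComponentIn hpA)⟩
    · rintro x ⟨hx, hxp⟩
      exact hint x (closure_minimal interior_subset (isClosed_entireHull X) hx) hxp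
  have hcl : IsClosed (_root_.connectedComponentIn A p) := by
    refine isClosed_of_closure_subset fun y hy => ?_
    have hyA : y ∈ A := hconv X hXA hXc
      (closure_minimal (hsub.trans interior_subset) (isClosed_entireHull X) hy)
    obtain ⟨q, hq1, hq2⟩ := mem_closure_iff.1 hy _ hA.connectedComponentIn
      (mem_connectedComponentIn hyA)
    rw [connectedComponentIn_eq hq2, ← connectedComponentIn_eq hq1]
    exact mem_connectedComponentIn hyA
  have huniv := IsClopen.eq_univ ⟨hcl, hO⟩ ⟨p, mem_connectedComponentIn hpA⟩
  exact hne (univ_subset_iff.1 (huniv ▸ connectedComponentIn_subset A p))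

/-- A holomorphic injection of a domain is a homeomorphism onto its image. -/
lemma nonempty_homeomorph_image {O : Set ℂ} (hO : IsOpen O) (hc : IsPreconnected O) {f : ℂ → ℂ}
    (hf : DifferentiableOn ℂ f O) (hinj : InjOn f O) : Nonempty (O ≃ₜ f '' O) := by
  let e : O ≃ f '' O := Equiv.Set.imageOfInjOn f O hinj
  have hcont : Continuous e :=
    Continuous.subtype_mk (continuousOn_iff_continuous_domRestrict.1 hf.continuousOn) _
  refine ⟨e.toHomeomorphOfContinuousOpen hcont ?_⟩
  have hopen : ∀ s ⊆ O, IsOpen s → IsOpen (f '' s) := by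
    rcases (hf.analyticOnNhd hO).is_constant_or_isOpen hc with ⟨w, hw⟩ | h
    · intro s hs hso
      rcases s.eq_empty_or_nonempty with rfl | ⟨x, hx⟩
      · simp
      exfalso
      obtain ⟨r, hr, hball⟩ := Metric.isOpen_iff.1 hO x (hs hx)
      have hy : x + (r / 2 : ℝ) ∈ O := hball (by
        rw [Metric.mem_ball, dist_eq_norm, add_sub_cancel_left, Complex.norm_real,
          Real.norm_of_nonneg (by positivity)]
        linarith)
      have := hinj (hs hx) hy ((hw x (hs hx)).trans (hw _ hy).symm)
      rw [left_eq_add, Complex.ofReal_eq_zero] at this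
      linarith
    · exact h
  intro V hV
  obtain ⟨W, hW, rfl⟩ := isOpen_induced_iff.1 hV
  have h1 := hopen (O ∩ W) inter_subset_left (hO.inter hW)
  refine isOpen_induced_iff.2 ⟨_, h1, ?_⟩
  ext ⟨y, hy⟩
  simp only [mem_preimage, mem_image]
  constructor
  · rintro ⟨x, ⟨hxO, hxW⟩, hxy⟩
    exact ⟨⟨x, hxO⟩, hxW, Subtype.ext hxy⟩
  · rintro ⟨⟨x, hxO⟩, hxW, hxy⟩
    exact ⟨x, ⟨hxO, hxW⟩, congrArg Subtype.val hxy⟩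

/-- A nonconstant locally uniform limit of injective holomorphic functions on a domain is
injective. -/
lemma injOn_of_tendstoLocallyUniformlyOn {ι : Type*} {l : Filter ι} [l.NeBot] {O : Set ℂ}
    (hO : IsOpen O) (hc : IsPreconnected O) {F : ι → ℂ → ℂ} {f : ℂ → ℂ}
    (hF : ∀ n, DifferentiableOn ℂ (F n) O) (hinj : ∀ n, InjOn (F n) O)
    (h : TendstoLocallyUniformlyOn F f l O) (hne : ¬ ∃ c, ∀ z ∈ O, f z = c) : InjOn f O := by
  intro a ha b hb hab
  by_contra hne'
  have hfd : DifferentiableOn ℂ f O := h.differentiableOn (Eventually.of_forall hF) hO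
  have hfa := hfd.analyticOnNhd hO
  have hiso : ∀ᶠ z in 𝓝[≠] b, f z ≠ f b := by
    rcases (hfa b hb).eventually_eq_or_eventually_ne (analyticAt_const (v := f b)) with h1 | h1
    · exact absurd ⟨f b, hfa.eqOn_of_preconnected_of_eventuallyEq
        (fun _ _ => analyticAt_const) hc hb h1⟩ hne
    · exact h1
  have hnb : ∀ᶠ z in 𝓝 b, z ∈ O ∧ z ≠ a ∧ (z ≠ b → f z ≠ f b) := by
    filter_upwards [hO.mem_nhds hb, isOpen_ne.mem_nhds (Ne.symm hne'),
      eventually_nhdsWithin_iff.1 hiso] with z h1 h2 h3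
    exact ⟨h1, h2, h3⟩
  obtain ⟨r, hr, hball⟩ := Metric.nhds_basis_closedBall.mem_iff.1 hnb
  have hsph : ∀ z ∈ Metric.sphere b r, f z - f b ≠ 0 := by
    intro z hz
    refine sub_ne_zero.2 ((hball (Metric.sphere_subset_closedBall hz)).2.2 ?_)
    rintro rfl
    simp at hz
    linarith
  have hsubO : Metric.closedBall b r ⊆ O := fun z hz => (hball hz).1
  obtain ⟨z₀, hz₀, hmin⟩ := (isCompact_sphere b r).exists_isMinOn
    (NormedSpace.sphere_nonempty.2 hr.le) (f := fun z => ‖f z - f b‖)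
    ((hfd.continuousOn.mono (Metric.sphere_subset_closedBall.trans hsubO)).sub
      continuousOn_const).norm
  have hm : 0 < ‖f z₀ - f b‖ := norm_pos_iff.2 (hsph z₀ hz₀)
  have hu := Metric.tendstoUniformlyOn_iff.1 ((tendstoLocallyUniformlyOn_iff_forall_isCompact hO).1
    h _ hsubO (isCompact_closedBall b r)) (‖f z₀ - f b‖ / 4) (by positivity)
  have hua := Metric.tendsto_nhds.1 (h.tendsto_at ha) (‖f z₀ - f b‖ / 4) (by positivity)
  obtain ⟨n, hn1, hn2⟩ := (hu.and hua).exists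
  have hg0 : ∀ z ∈ Metric.closedBall b r, F n z - F n a ≠ 0 := by
    intro z hz hcon
    exact (hball hz).2.1 (hinj n (hsubO hz) ha (sub_eq_zero.1 hcon))
  have hdiff : DifferentiableOn ℂ (fun z => (F n z - F n a)⁻¹) (Metric.closedBall b r) :=
    (((hF n).mono hsubO).sub_const _).inv hg0
  have hmax := Complex.norm_le_of_forall_mem_frontier_norm_le (U := Metric.ball b r)
    (C := (‖f z₀ - f b‖ / 2)⁻¹) Metric.isBounded_ball
    (DifferentiableOn.diffContOnCl (by rwa [closure_ball b hr.ne'])) (fun z hz => by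
      rw [frontier_ball b hr.ne'] at hz
      have h1 := hn1 z (Metric.sphere_subset_closedBall hz)
      have h2 : ‖f z₀ - f b‖ ≤ ‖f z - f b‖ := hmin hz
      rw [dist_eq_norm] at h1 hn2
      rw [norm_inv]
      apply inv_anti₀ (by positivity)
      have h3 : f z - f b = (F n z - F n a) + (f z - F n z) + (F n a - f a) := by
        rw [hab]; ring
      have h4 := norm_add₃_le (a := F n z - F n a) (b := f z - F n z) (c := F n a - f a)
      rw [← h3] at h4
      linarith) (subset_closure (Metric.mem_ball_self hr))
  have hb1 := hn1 b (Metric.mem_closedBall_self hr.le)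
  rw [dist_eq_norm] at hb1 hn2
  rw [norm_inv] at hmax
  have hpos : 0 < ‖F n b - F n a‖ :=
    norm_pos_iff.2 (hg0 b (Metric.mem_closedBall_self hr.le))
  have h5 := (inv_le_inv₀ hpos (by positivity)).1 hmax
  have h3 : F n b - F n a = -(f b - F n b) - (F n a - f a) := by rw [hab]; ring
  have h4 := norm_sub_le (-(f b - F n b)) (F n a - f a)
  rw [← h3, norm_neg] at h4
  linarith

/-- A form of Montel's theorem along an ultrafilter. -/
lemma exists_tendstoLocallyUniformlyOn_of_mapsTo_ball {ι : Type*} (l : Ultrafilter ι) {O : Set ℂ}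
    (hO : IsOpen O) {F : ι → ℂ → ℂ} (hF : ∀ n, DifferentiableOn ℂ (F n) O)
    (hball : ∀ n, MapsTo (F n) O (Metric.ball 0 1)) :
    ∃ f : ℂ → ℂ, TendstoLocallyUniformlyOn F f l O := by
  have hlim : ∀ z ∈ O, ∃ a, Tendsto (fun n => F n z) l (𝓝 a) := by
    intro z hz
    obtain ⟨a, -, ha⟩ := (isCompact_closedBall (0 : ℂ) 1).ultrafilter_le_nhds
      (l.map fun n => F n z) (by
        rw [le_principal_iff]
        exact Filter.mem_map.2 (univ_mem' fun n => Metric.ball_subset_closedBall (hball n hz)))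
    exact ⟨a, ha⟩
  choose! f hf using hlim
  refine ⟨f, ?_⟩
  rw [Metric.tendstoLocallyUniformlyOn_iff]
  intro ε hε x hx
  obtain ⟨R, hR, hsub⟩ := Metric.isOpen_iff.1 hO x hx
  have hlip : ∀ n, ∀ y ∈ Metric.ball x R, dist (F n y) (F n x) ≤ 2 / R * dist y x := by
    intro n y hy
    refine Complex.dist_le_div_mul_dist_of_mapsTo_ball ((hF n).mono hsub) (fun z hz => ?_) hy
    rw [Metric.mem_closedBall]
    have h1 := hball n (hsub hz)
    have h2 := hball n hx
    rw [Metric.mem_ball] at h1 h2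
    linarith [dist_triangle_right (F n z) (F n x) 0]
  have hlip' : ∀ y ∈ Metric.ball x R, dist (f y) (f x) ≤ 2 / R * dist y x := fun y hy =>
    le_of_tendsto ((hf y (hsub hy)).dist (hf x hx)) (Eventually.of_forall fun n => hlip n y hy)
  refine ⟨Metric.ball x (min R (R * ε / 8)),
    mem_nhdsWithin_of_mem_nhds (Metric.ball_mem_nhds _ (by positivity)), ?_⟩
  filter_upwards [Metric.tendsto_nhds.1 (hf x hx) (ε / 2) (by positivity)] with n hn y hy
  rw [Metric.mem_ball, lt_min_iff] at hy
  have h1 := hlip n y hy.1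
  have h2 := hlip' y hy.1
  have h3 : 2 / R * dist y x ≤ ε / 4 := by
    calc 2 / R * dist y x ≤ 2 / R * (R * ε / 8) := by gcongr; exact hy.2.le
      _ = ε / 4 := by field_simp; norm_num
  have h4 := dist_triangle4 (f y) (f x) (F n x) (F n y)
  rw [dist_comm (f x) (F n x), dist_comm (F n x) (F n y)] at h4
  linarith

lemma norm_moebius_lt_one {c z : ℂ} (hc : ‖c‖ < 1) (hz : ‖z‖ < 1) :
    ‖(z - c) * (1 - (starRingEnd ℂ) c * z)⁻¹‖ < 1 := by
  have h1 : ‖z - c‖ ^ 2 < ‖1 - (starRingEnd ℂ) c * z‖ ^ 2 := by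
    have e : ‖1 - (starRingEnd ℂ) c * z‖ ^ 2 - ‖z - c‖ ^ 2 = (1 - ‖c‖ ^ 2) * (1 - ‖z‖ ^ 2) := by
      simp only [← Complex.normSq_eq_norm_sq, Complex.normSq_apply]
      simp
      ring
    have : 0 < (1 - ‖c‖ ^ 2) * (1 - ‖z‖ ^ 2) := by
      apply mul_pos <;> nlinarith [norm_nonneg c, norm_nonneg z]
    linarith
  have h2 : ‖z - c‖ < ‖1 - (starRingEnd ℂ) c * z‖ := lt_of_pow_lt_pow_left₀ 2 (norm_nonneg _) h1
  rw [norm_mul, norm_inv, ← div_eq_mul_inv]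
  exact (div_lt_one ((norm_nonneg _).trans_lt h2)).2 h2

lemma one_sub_conj_mul_ne_zero {c z : ℂ} (hc : ‖c‖ < 1) (hz : ‖z‖ < 1) :
    1 - (starRingEnd ℂ) c * z ≠ 0 := by
  intro h
  have h1 : ‖(starRingEnd ℂ) c * z‖ = 1 := by rw [← sub_eq_zero.1 h, norm_one]
  rw [norm_mul, RCLike.norm_conj] at h1
  nlinarith [norm_nonneg c, norm_nonneg z]

lemma moebius_injective {c z w : ℂ} (hc : ‖c‖ < 1) (hz : ‖z‖ < 1) (hw : ‖w‖ < 1)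
    (h : (z - c) * (1 - (starRingEnd ℂ) c * z)⁻¹ = (w - c) * (1 - (starRingEnd ℂ) c * w)⁻¹) :
    z = w := by
  have h1 := one_sub_conj_mul_ne_zero hc hz
  have h2 := one_sub_conj_mul_ne_zero hc hw
  rw [← div_eq_mul_inv, ← div_eq_mul_inv, div_eq_div_iff h1 h2] at h
  have h3 : (1 - (starRingEnd ℂ) c * c) * (z - w) = 0 := by linear_combination h
  exact sub_eq_zero.1 ((mul_eq_zero.1 h3).resolve_left (one_sub_conj_mul_ne_zero hc hc))

lemma HasDerivAt.moebius {f : ℂ → ℂ} {f' p c : ℂ} (hf : HasDerivAt f f' p) (hc : ‖c‖ < 1)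
    (hp : ‖f p‖ < 1) :
    HasDerivAt (fun z => (f z - c) * (1 - (starRingEnd ℂ) c * f z)⁻¹)
      (f' * (1 - (starRingEnd ℂ) c * c) / (1 - (starRingEnd ℂ) c * f p) ^ 2) p := by
  have h1 := one_sub_conj_mul_ne_zero hc hp
  have := (hf.sub_const c).mul (((hf.const_mul ((starRingEnd ℂ) c)).const_sub 1).fun_inv h1)
  refine this.congr_deriv ?_
  field_simp
  ring

lemma EntireApprox.moebius {O : Set ℂ} (hO : IsOpen O) (hconv : HullConvex O) {f : ℂ → ℂ}
    (hf : EntireApprox O f) {c : ℂ} (hc : ‖c‖ < 1) (hball : MapsTo f O (Metric.ball 0 1)) :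
    EntireApprox O (fun z => (f z - c) * (1 - (starRingEnd ℂ) c * f z)⁻¹) := by
  refine EntireApprox.mul hO (hf.comp hO (φ := fun z => z - c) (by fun_prop))
    (EntireApprox.inv hO hconv (hf.comp hO (φ := fun z => 1 - (starRingEnd ℂ) c * z)
      (by fun_prop)) fun z hz => one_sub_conj_mul_ne_zero hc (by simpa using hball hz))

/-- A form of the Riemann mapping theorem for hull convex domains in a half-plane. -/
theorem exists_riemann_map {O : Set ℂ} (hO : IsOpen O) (hc : IsPreconnected O)
    (hconv : HullConvex O) (hne : O.Nonempty) {ρ : ℝ} (hρ : ∀ z ∈ O, ρ < z.re) :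
    ∃ f : ℂ → ℂ, DifferentiableOn ℂ f O ∧ InjOn f O ∧ f '' O = Metric.ball 0 1 := by
  obtain ⟨p, hp⟩ := hne
  let 𝓕 : Set (ℂ → ℂ) :=
    {f | EntireApprox O f ∧ InjOn f O ∧ MapsTo f O (Metric.ball 0 1) ∧ f p = 0}
  obtain ⟨f₀, hf₀, hf₀'⟩ : ∃ f₀ ∈ 𝓕, deriv f₀ p ≠ 0 := by
    obtain ⟨q, hq⟩ : ∃ q : ℂ, q = 2 * ρ - (starRingEnd ℂ) p := ⟨_, rfl⟩
    have hqre : q.re = 2 * ρ - p.re := by simp [hq]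
    have hqim : q.im = p.im := by simp [hq]
    have hzq : ∀ z ∈ O, z - q ≠ 0 := by
      intro z hz h
      have h1 := congrArg Complex.re (sub_eq_zero.1 h)
      linarith [hρ z hz, hρ p hp]
    refine ⟨fun z => (z - p) * (z - q)⁻¹, ⟨?_, ?_, ?_, by simp⟩, ?_⟩
    · exact EntireApprox.mul hO (Differentiable.entireApprox (u := fun z => z - p) (by fun_prop) O)
        (EntireApprox.inv hO hconv (Differentiable.entireApprox (u := fun z => z - q)
          (by fun_prop) O) hzq)
    · intro z hz w hw h
      simp only [← div_eq_mul_inv] at h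
      rw [div_eq_div_iff (hzq z hz) (hzq w hw)] at h
      have h1 : (p - q) * (z - w) = 0 := by linear_combination h
      exact sub_eq_zero.1 ((mul_eq_zero.1 h1).resolve_left (hzq p hp))
    · intro z hz
      rw [mem_ball_zero_iff, norm_mul, norm_inv, ← div_eq_mul_inv,
        div_lt_one (norm_pos_iff.2 (hzq z hz))]
      apply lt_of_pow_lt_pow_left₀ 2 (norm_nonneg _)
      simp only [← Complex.normSq_eq_norm_sq, Complex.normSq_apply, Complex.sub_re,
        Complex.sub_im, hqre, hqim]
      nlinarith [hρ z hz, hρ p hp]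
    · have h1 := ((hasDerivAt_id p).sub_const p).fun_mul
        (((hasDerivAt_id p).sub_const q).fun_inv (hzq p hp))
      simp only [id] at h1
      rw [h1.deriv]
      simpa using hzq p hp
  obtain ⟨R, hR, hsub⟩ := Metric.isOpen_iff.1 hO p hp
  have hbdd : BddAbove ((fun f => ‖deriv f p‖) '' 𝓕) := by
    refine ⟨1 / R, ?_⟩
    rintro _ ⟨f, ⟨hf1, -, hf3, hf4⟩, rfl⟩
    refine Complex.norm_deriv_le_div_of_mapsTo_ball ((hf1.differentiableOn hO).mono hsub) ?_ hR
    rw [hf4]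
    exact fun z hz => Metric.ball_subset_closedBall (hf3 (hsub hz))
  obtain ⟨u, -, hu, hmem⟩ := exists_seq_tendsto_sSup ⟨_, mem_image_of_mem _ hf₀⟩ hbdd
  obtain ⟨S, hS⟩ : ∃ S, S = sSup ((fun f => ‖deriv f p‖) '' 𝓕) := ⟨_, rfl⟩
  have hle : ∀ f ∈ 𝓕, ‖deriv f p‖ ≤ S := fun f hf => hS ▸ le_csSup hbdd (mem_image_of_mem _ hf)
  rw [← hS] at hu
  choose F hF hFu using hmem
  have hS0 : 0 < S := (norm_pos_iff.2 hf₀').trans_le (hle f₀ hf₀)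
  obtain ⟨f, hf⟩ := exists_tendstoLocallyUniformlyOn_of_mapsTo_ball (hyperfilter ℕ) hO
    (fun n => (hF n).1.differentiableOn hO) (fun n => (hF n).2.2.1)
  have hfE : EntireApprox O f := entireApprox_of_tendsto hO (fun n => (hF n).1) hf
  have hfd := hfE.differentiableOn hO
  have hfp : f p = 0 := tendsto_nhds_unique (hf.tendsto_at hp)
    (by simp only [(hF _).2.2.2]; exact tendsto_const_nhds)
  have hfS : ‖deriv f p‖ = S := by
    have h1 := ((hf.deriv (Eventually.of_forall fun n => (hF n).1.differentiableOn hO)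
      hO).tendsto_at hp).norm
    refine tendsto_nhds_unique h1 ?_
    have h2 : Tendsto u (hyperfilter ℕ) (𝓝 S) := hu.mono_left (Nat.hyperfilter_le_atTop)
    exact h2.congr fun n => (hFu n).symm
  have hnc : ¬ ∃ c, ∀ z ∈ O, f z = c := by
    rintro ⟨c, hcon⟩
    have : f =ᶠ[𝓝 p] fun _ => c := by
      filter_upwards [hO.mem_nhds hp] with z hz using hcon z hz
    rw [this.deriv_eq, deriv_const, norm_zero] at hfS
    linarith
  have hfinj : InjOn f O := injOn_of_tendstoLocallyUniformlyOn hO hc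
    (fun n => (hF n).1.differentiableOn hO) (fun n => (hF n).2.1) hf hnc
  have hfle : ∀ z ∈ O, ‖f z‖ ≤ 1 := fun z hz =>
    le_of_tendsto (hf.tendsto_at hz).norm
      (Eventually.of_forall fun n => (mem_ball_zero_iff.1 ((hF n).2.2.1 hz)).le)
  have hfball : MapsTo f O (Metric.ball 0 1) := by
    intro z hz
    rw [mem_ball_zero_iff]
    refine lt_of_le_of_ne (hfle z hz) fun h1 => hnc ⟨f z, ?_⟩
    exact Complex.eqOn_of_isPreconnected_of_isMaxOn_norm hc hO hfd hz
      (fun w hw => by simpa [h1] using hfle w hw)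
  refine ⟨f, hfd, hfinj, hfball.image_subset.antisymm ?_⟩
  intro c hcb
  rw [mem_ball_zero_iff] at hcb
  by_contra hcon
  have homit : ∀ z ∈ O, f z - c ≠ 0 := fun z hz h => hcon ⟨z, hz, sub_eq_zero.1 h⟩
  have hlt : ∀ z ∈ O, ‖f z‖ < 1 := fun z hz => mem_ball_zero_iff.1 (hfball hz)
  obtain ⟨s, hsE, hs⟩ := (hfE.moebius hO hconv hcb hfball).exists_sqrt hO hc hconv
    (fun z hz => mul_ne_zero (homit z hz)
      (inv_ne_zero (one_sub_conj_mul_ne_zero hcb (hlt z hz))))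
  have hslt : ∀ z ∈ O, ‖s z‖ < 1 := by
    intro z hz
    have h1 := norm_moebius_lt_one hcb (hlt z hz)
    rw [← hs z hz, norm_pow] at h1
    exact (pow_lt_one_iff_of_nonneg (norm_nonneg _) two_ne_zero).1 h1
  have hsinj : InjOn s O := by
    intro z hz w hw h
    apply hfinj hz hw
    apply moebius_injective hcb (hlt z hz) (hlt w hw)
    rw [← hs z hz, ← hs w hw, h]
  have hT : (fun z => (s z - s p) * (1 - (starRingEnd ℂ) (s p) * s z)⁻¹) ∈ 𝓕 := by
    refine ⟨hsE.moebius hO hconv (hslt p hp) fun z hz => mem_ball_zero_iff.2 (hslt z hz), ?_, ?_,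
      by simp⟩
    · intro z hz w hw h
      exact hsinj hz hw (moebius_injective (hslt p hp) (hslt z hz) (hslt w hw) h)
    · exact fun z hz => mem_ball_zero_iff.2 (norm_moebius_lt_one (hslt p hp) (hslt z hz))
  have hsd := ((hsE.differentiableOn hO).differentiableAt (hO.mem_nhds hp)).hasDerivAt
  have hfd' := (hfd.differentiableAt (hO.mem_nhds hp)).hasDerivAt
  have h1 := hle _ hT
  rw [(hsd.moebius (hslt p hp) (hslt p hp)).deriv] at h1
  have h2 : 2 * s p * deriv s p = deriv f p * (1 - (starRingEnd ℂ) c * c) := by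
    have e1 : (fun z => s z ^ 2) =ᶠ[𝓝 p]
        fun z => (f z - c) * (1 - (starRingEnd ℂ) c * f z)⁻¹ := by
      filter_upwards [hO.mem_nhds hp] with z hz using hs z hz
    have e2 := e1.deriv_eq
    rw [(hfd'.moebius hcb (hlt p hp)).deriv, (hsd.fun_pow 2).deriv, hfp] at e2
    simpa using e2
  have hsp := hs p hp
  rw [hfp] at hsp
  have h3 : ‖s p‖ ^ 2 = ‖c‖ := by
    rw [← norm_pow, hsp]
    simp
  have hconj : ∀ a : ℂ, ‖a‖ < 1 → ‖1 - (starRingEnd ℂ) a * a‖ = 1 - ‖a‖ ^ 2 := by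
    intro a ha
    rw [mul_comm, Complex.mul_conj, Complex.normSq_eq_norm_sq, ← Complex.ofReal_one,
      ← Complex.ofReal_sub, Complex.norm_real, Real.norm_of_nonneg]
    nlinarith [norm_nonneg a]
  have h4 := congrArg norm h2
  rw [norm_mul, norm_mul, norm_mul, hconj c hcb, hfS, Complex.norm_ofNat] at h4
  have hx1 := hslt p hp
  have hx0 : 0 < ‖s p‖ := by
    have hc0 : 0 < ‖c‖ := by
      rw [norm_pos_iff]
      rintro rfl
      exact homit p hp (by rw [hfp, sub_zero])
    rw [← h3] at hc0
    exact (norm_nonneg _).lt_of_ne' fun h => by simp [h] at hc0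
  rw [norm_div, norm_mul, norm_pow, hconj _ hx1] at h1
  have hd : 0 < 1 - ‖s p‖ ^ 2 := by nlinarith
  have h5 : ‖deriv s p‖ ≤ S * (1 - ‖s p‖ ^ 2) := by
    rw [div_le_iff₀ (by positivity)] at h1
    have : ‖deriv s p‖ * (1 - ‖s p‖ ^ 2) ≤ S * (1 - ‖s p‖ ^ 2) * (1 - ‖s p‖ ^ 2) := by
      linarith
    exact le_of_mul_le_mul_right this hd
  rw [← h3] at h4
  have h6 : S * (1 - ‖s p‖ ^ 2) * (1 + ‖s p‖ ^ 2) ≤ S * (1 - ‖s p‖ ^ 2) * (2 * ‖s p‖) := by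
    calc _ = 2 * ‖s p‖ * ‖deriv s p‖ := by rw [h4]; ring
      _ ≤ 2 * ‖s p‖ * (S * (1 - ‖s p‖ ^ 2)) := by gcongr
      _ = _ := by ring
  have h7 := le_of_mul_le_mul_left h6 (by positivity)
  nlinarith [sq_nonneg (1 - ‖s p‖)]

/-- The sequence `F` tends to infinity locally uniformly on `N`. -/
def DivergesOn (F : ℕ → ℂ → ℂ) (N : Set ℂ) : Prop :=
  ∀ z ∈ N, ∃ V ∈ 𝓝 z, ∀ M : ℝ, ∀ᶠ n in atTop, ∀ y ∈ V, M < ‖F n y‖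

lemma DivergesOn.mono {F : ℕ → ℂ → ℂ} {N N' : Set ℂ} (h : DivergesOn F N) (hN : N' ⊆ N) :
    DivergesOn F N' := fun z hz => h z (hN hz)

lemma DivergesOn.exists_open {F : ℕ → ℂ → ℂ} {K : Set ℂ} (h : DivergesOn F K)
    (hK : IsCompact K) :
    ∃ V, IsOpen V ∧ K ⊆ V ∧ ∀ M : ℝ, ∀ᶠ n in atTop, ∀ y ∈ V, M < ‖F n y‖ := by
  refine hK.induction_on (p := fun K => ∃ V, IsOpen V ∧ K ⊆ V ∧
    ∀ M : ℝ, ∀ᶠ n in atTop, ∀ y ∈ V, M < ‖F n y‖) ⟨∅, isOpen_empty, Subset.rfl, by simp⟩ ?_ ?_ ?_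
  · rintro s t hst ⟨V, hV, htV, hM⟩
    exact ⟨V, hV, hst.trans htV, hM⟩
  · rintro s t ⟨V, hV, hs, hM⟩ ⟨V', hV', ht, hM'⟩
    refine ⟨V ∪ V', hV.union hV', union_subset_union hs ht, fun M => ?_⟩
    filter_upwards [hM M, hM' M] with n h1 h2 y hy
    exact hy.elim (h1 y) (h2 y)
  · intro z hz
    obtain ⟨V, hV, hM⟩ := h z hz
    refine ⟨interior V, mem_nhdsWithin_of_mem_nhds (interior_mem_nhds.2 hV), interior V,
      isOpen_interior, Subset.rfl, fun M => ?_⟩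
    filter_upwards [hM M] with n hn y hy
    exact hn y (interior_subset hy)

lemma exp_add_int_mul_two_pi_mul_I (w : ℂ) (k : ℤ) :
    Complex.exp (w + k * (2 * Real.pi * I)) = Complex.exp w :=
  Complex.exp_periodic.int_mul k w

/-- If `Φ n` are primitives of `exp / (exp - exp q) * (1 - P ^ n)`, where `P` is `2πi`-periodic
and bounded by `c < 1`, then increments of `Φ n` converge to those of a primitive of
`exp / (exp - exp q)`. -/
lemma tendsto_increment {N : Set ℂ} (hN : IsOpen N) (hc : IsPreconnected N) {v w : ℂ}
    (hv : v ∈ N) (hw : w ∈ N) {κ P L : ℂ → ℂ} {Φ : ℕ → ℂ → ℂ} {c : ℝ} (hc1 : c < 1)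
    (hP : ∀ z ∈ N, ‖P z‖ ≤ c) (hκ : ContinuousOn κ N) (hL : ∀ z ∈ N, HasDerivAt L (κ z) z)
    (hΦ : ∀ n, ∀ z ∈ N, HasDerivAt (Φ n) (κ z * (1 - P z ^ n)) z) :
    Tendsto (fun n => Φ n w - Φ n v) atTop (𝓝 (L w - L v)) := by
  have hc0 : 0 ≤ c := (norm_nonneg _).trans (hP v hv)
  have key : TendstoLocallyUniformlyOn (fun n z => Φ n z - Φ n v - (L z - L v)) (fun _ => 0)
      atTop N := by
    refine tendstoLocallyUniformlyOn_zero_of_deriv hN hc (D' := fun n z => -(κ z * P z ^ n))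
      (fun n z hz => (((hΦ n z hz).sub_const _).sub ((hL z hz).sub_const _)).congr_deriv
        (by ring)) ?_ hv (by simp)
    rw [Metric.tendstoLocallyUniformlyOn_iff]
    intro ε hε z hz
    have h1 : ∀ᶠ y in 𝓝[N] z, ‖κ y‖ < ‖κ z‖ + 1 :=
      (hκ z hz).norm.eventually_lt_const (by linarith)
    refine ⟨{y | y ∈ N ∧ ‖κ y‖ < ‖κ z‖ + 1}, eventually_mem_nhdsWithin.and h1, ?_⟩
    have h2 : Tendsto (fun n => (‖κ z‖ + 1) * c ^ n) atTop (𝓝 ((‖κ z‖ + 1) * 0)) :=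
      (tendsto_pow_atTop_nhds_zero_of_lt_one hc0 hc1).const_mul _
    rw [mul_zero] at h2
    filter_upwards [h2.eventually_lt_const hε] with n hn y hy
    rw [dist_zero_left, norm_neg, norm_mul, norm_pow]
    refine lt_of_le_of_lt ?_ hn
    gcongr
    · exact hy.2.le
    · exact hP y hy.1
  have h := (key.tendsto_at hw).add_const (L w - L v)
  simpa using h

/-- If two sets winding around `0`, separated by the circle through `exp q`, carry a small bound
for `P`, then `P` cannot be equal to one at `exp q`. -/
lemma ne_one_of_winding {N₀ N₁ : Set ℂ} (hN₀ : IsOpen N₀) (hc₀ : IsPreconnected N₀)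
    (hN₁ : IsOpen N₁) (hc₁ : IsPreconnected N₁) {w₀ w₁ q : ℂ} {k₀ k₁ : ℤ} (hk₀ : k₀ ≠ 0)
    (hk₁ : k₁ ≠ 0) (hw₀ : w₀ ∈ N₀) (hw₀' : w₀ + k₀ * (2 * Real.pi * I) ∈ N₀) (hw₁ : w₁ ∈ N₁)
    (hw₁' : w₁ + k₁ * (2 * Real.pi * I) ∈ N₁) (hq₀ : ∀ w ∈ N₀, w.re < q.re)
    (hq₁ : ∀ w ∈ N₁, q.re < w.re) {P : ℂ → ℂ} (hP : DifferentiableOn ℂ P {0}ᶜ) {c : ℝ}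
    (hc1 : c < 1) (hPc : ∀ w ∈ N₀ ∪ N₁, ‖P (Complex.exp w)‖ ≤ c) : P (Complex.exp q) ≠ 1 := by
  intro hP1
  set a := Complex.exp q with ha
  have ha0 : a ≠ 0 := Complex.exp_ne_zero q
  have hne : ∀ w : ℂ, w.re ≠ q.re → Complex.exp w - a ≠ 0 := by
    intro w hw h
    have := congrArg norm (sub_eq_zero.1 h)
    rw [ha, Complex.norm_exp, Complex.norm_exp] at this
    exact hw (Real.exp_injective this)
  let φ : ℕ → ℂ → ℂ := fun n w => Complex.exp w * -dslope (fun z => P z ^ n) a (Complex.exp w)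
  have hφ : ∀ n, Differentiable ℂ (φ n) := by
    intro n
    have h1 : DifferentiableOn ℂ (dslope (fun z => P z ^ n) a) {0}ᶜ :=
      (differentiableOn_dslope (isOpen_compl_singleton.mem_nhds ha0)).2 (hP.fun_pow n)
    intro w
    have h2 : DifferentiableAt ℂ (dslope (fun z => P z ^ n) a) (Complex.exp w) :=
      h1.differentiableAt (isOpen_compl_singleton.mem_nhds (Complex.exp_ne_zero w))
    exact Complex.differentiableAt_exp.mul (h2.comp w Complex.differentiableAt_exp).neg
  have hφ' : ∀ n w, w.re ≠ q.re →
      φ n w = Complex.exp w / (Complex.exp w - a) * (1 - P (Complex.exp w) ^ n) := by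
    intro n w hw
    have h1 := sub_smul_dslope (fun z => P z ^ n) a (Complex.exp w)
    have h2 := hne w hw
    simp only [hP1, one_pow, smul_eq_mul] at h1
    simp only [φ]
    field_simp
    linear_combination -h1
  have hex : ∀ n, ∃ Φ : ℂ → ℂ, ∀ w, HasDerivAt Φ (φ n w) w := fun n => by
    obtain ⟨Φ, hΦ⟩ := (hφ n).isExactOn_univ
    exact ⟨Φ, fun w => hΦ w (mem_univ w)⟩
  choose Φ hΦ using hex
  have hconst : ∀ n (k : ℤ) w, Φ n (w + k * (2 * Real.pi * I)) - Φ n w =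
      k * (Φ n (2 * Real.pi * I) - Φ n 0) := by
    have h1 : ∀ n w, Φ n (w + 2 * Real.pi * I) - Φ n w = Φ n (2 * Real.pi * I) - Φ n 0 := by
      intro n w
      have hd : ∀ w, HasDerivAt (fun w => Φ n (w + 2 * Real.pi * I) - Φ n w) 0 w := by
        intro w
        refine (((hΦ n (w + 2 * Real.pi * I)).comp_add_const w _).sub (hΦ n w)).congr_deriv ?_
        simp only [φ]
        rw [Complex.exp_periodic w, sub_self]
      have := is_const_of_deriv_eq_zero (fun w => (hd w).differentiableAt)
        (fun w => (hd w).deriv) w 0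
      simpa using this
    intro n k
    induction k with
    | zero => simp
    | succ k ih =>
      intro w
      have h2 := h1 n (w + k * (2 * Real.pi * I))
      have h3 := ih w
      push_cast at h3 ⊢
      rw [show w + ((k : ℂ) + 1) * (2 * Real.pi * I) = w + k * (2 * Real.pi * I) + 2 * Real.pi * I
        by ring]
      linear_combination h2 + h3
    | pred k ih =>
      intro w
      have h2 := h1 n (w + (-(k : ℂ) - 1) * (2 * Real.pi * I))
      have h3 := ih w
      push_cast at h3 ⊢
      rw [show w + (-(k : ℂ) - 1) * (2 * Real.pi * I) + 2 * Real.pi * I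
        = w + -(k : ℂ) * (2 * Real.pi * I) by ring] at h2
      linear_combination h3 - h2
  have hκ : ∀ N : Set ℂ, (∀ w ∈ N, w.re ≠ q.re) →
      ContinuousOn (fun w => Complex.exp w / (Complex.exp w - a)) N := fun N hN =>
    Complex.continuous_exp.continuousOn.div (by fun_prop) fun w hw => hne w (hN w hw)
  have hn₀ : ∀ w ∈ N₀, w.re ≠ q.re := fun w hw => (hq₀ w hw).ne
  have hn₁ : ∀ w ∈ N₁, w.re ≠ q.re := fun w hw => (hq₁ w hw).ne'
  have hslit : ∀ v : ℂ, v.re < 0 → 1 - Complex.exp v ∈ Complex.slitPlane := by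
    intro v hv
    left
    rw [Complex.sub_re, Complex.one_re, sub_pos]
    refine (Complex.re_le_norm _).trans_lt ?_
    rwa [Complex.norm_exp, Real.exp_lt_one_iff]
  have t₀ := tendsto_increment hN₀ hc₀ hw₀ hw₀' (P := fun w => P (Complex.exp w)) hc1
    (fun w hw => hPc w (Or.inl hw)) (hκ N₀ hn₀)
    (L := fun w => Complex.log (1 - Complex.exp (w - q))) (fun w hw => by
      have hs := hslit (w - q) (by simpa using hq₀ w hw)
      refine ((((hasDerivAt_id w).sub_const q).cexp.const_sub 1).clog hs).congr_deriv ?_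
      have h1 := Complex.slitPlane_ne_zero hs
      have h2 := hne w (hn₀ w hw)
      have h3 : Complex.exp (w - q) = Complex.exp w / a := Complex.exp_sub w q
      simp only [id, h3] at h1 ⊢
      have h4 : a - Complex.exp w ≠ 0 := by rw [← neg_sub]; exact neg_ne_zero.2 h2
      field_simp
      ring) (Φ := Φ) (fun n w hw => (hΦ n w).congr_deriv (hφ' n w (hn₀ w hw)))
  have t₁ := tendsto_increment hN₁ hc₁ hw₁ hw₁' (P := fun w => P (Complex.exp w)) hc1
    (fun w hw => hPc w (Or.inr hw)) (hκ N₁ hn₁)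
    (L := fun w => w + Complex.log (1 - Complex.exp (q - w))) (fun w hw => by
      have hs := hslit (q - w) (by simpa using hq₁ w hw)
      refine ((hasDerivAt_id w).add
        ((((hasDerivAt_id w).const_sub q).cexp.const_sub 1).clog hs)).congr_deriv ?_
      have h1 := Complex.slitPlane_ne_zero hs
      have h2 := hne w (hn₁ w hw)
      have h3 : Complex.exp (q - w) = a / Complex.exp w := Complex.exp_sub q w
      have h4 := Complex.exp_ne_zero w
      simp only [id, h3] at h1 ⊢
      field_simp
      ring) (Φ := Φ) (fun n w hw => (hΦ n w).congr_deriv (hφ' n w (hn₁ w hw)))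
  simp only [hconst] at t₀ t₁
  have e₀ : Complex.exp (w₀ + k₀ * (2 * Real.pi * I) - q) = Complex.exp (w₀ - q) := by
    rw [← exp_add_int_mul_two_pi_mul_I (w₀ - q) k₀]; ring_nf
  have e₁ : Complex.exp (q - (w₁ + k₁ * (2 * Real.pi * I))) = Complex.exp (q - w₁) := by
    rw [← exp_add_int_mul_two_pi_mul_I (q - (w₁ + k₁ * (2 * Real.pi * I))) k₁]; ring_nf
  rw [e₀, sub_self] at t₀
  rw [e₁, show w₁ + k₁ * (2 * Real.pi * I) + Complex.log (1 - Complex.exp (q - w₁)) -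
    (w₁ + Complex.log (1 - Complex.exp (q - w₁))) = k₁ * (2 * Real.pi * I) by ring] at t₁
  have hk₀' : (k₀ : ℂ) ≠ 0 := by exact_mod_cast hk₀
  have hk₁' : (k₁ : ℂ) ≠ 0 := by exact_mod_cast hk₁
  have s₀ := t₀.const_mul ((k₀ : ℂ)⁻¹)
  have s₁ := t₁.const_mul ((k₁ : ℂ)⁻¹)
  simp only [inv_mul_cancel_left₀ hk₀', inv_mul_cancel_left₀ hk₁', mul_zero] at s₀ s₁
  exact Complex.two_pi_I_ne_zero (tendsto_nhds_unique s₁ s₀)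

/-- Inside the logarithmic lift of a set on which `F` diverges, a compact connected set joining two
points with the same exponential has a neighborhood as required in `ne_one_of_winding`. -/
lemma DivergesOn.exists_lift {F : ℕ → ℂ → ℂ} {U : Set ℂ} (h : DivergesOn F U) {O : Set ℂ}
    (hO : IsOpen O) (hc : IsPreconnected O) (hOU : ∀ w ∈ O, Complex.exp w ∈ U) {ρ : ℝ}
    (hρ : ∀ w ∈ O, ρ < w.re) {v w : ℂ} (hv : v ∈ O) (hw : w ∈ O) :
    ∃ (N : Set ℂ) (R : ℝ), IsOpen N ∧ IsPreconnected N ∧ v ∈ N ∧ w ∈ N ∧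
      (∀ y ∈ N, ρ < y.re ∧ y.re < R) ∧
      ∀ M : ℝ, ∀ᶠ n in atTop, ∀ y ∈ N, M < ‖F n (Complex.exp y)‖ := by
  have hpc : IsPathConnected O := hO.isConnected_iff_isPathConnected.1 ⟨⟨v, hv⟩, hc⟩
  obtain ⟨γ, hγ⟩ := hpc.joinedIn v hv w hw
  have hC : IsCompact (range γ) := isCompact_range γ.continuous
  have hCc : IsPreconnected (range γ) := isPreconnected_range γ.continuous
  have hCO : range γ ⊆ O := range_subset_iff.2 hγ
  have hvC : v ∈ range γ := ⟨0, γ.source⟩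
  have hwC : w ∈ range γ := ⟨1, γ.target⟩
  obtain ⟨V, hV, hCV, hVM⟩ := (h.mono (image_subset_iff.2 fun y hy => hOU y (hCO hy))).exists_open
    (hC.image Complex.continuous_exp)
  obtain ⟨R, hR⟩ := hC.bddAbove_image Complex.continuous_re.continuousOn
  set A : Set ℂ := Complex.exp ⁻¹' V ∩ (Complex.re ⁻¹' Ioo ρ (R + 1)) with hA
  have hAo : IsOpen A := (hV.preimage Complex.continuous_exp).inter
    (isOpen_Ioo.preimage Complex.continuous_re)
  have hCA : range γ ⊆ A := fun y hy => ⟨hCV (mem_image_of_mem _ hy), hρ y (hCO hy),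
    (hR (mem_image_of_mem _ hy)).trans_lt (lt_add_one R)⟩
  have hsub := connectedComponentIn_subset A v
  refine ⟨connectedComponentIn A v, R + 1, hAo.connectedComponentIn,
    isPreconnected_connectedComponentIn, mem_connectedComponentIn (hCA hvC),
    hCc.subset_connectedComponentIn hvC hCA hwC, fun y hy => (hsub hy).2, fun M => ?_⟩
  filter_upwards [hVM M] with n hn y hy
  exact hn _ (hsub hy).1

/-- If `F` diverges on a set containing curves winding around `0` arbitrarily close to infinity,
then `F` diverges near infinity. -/
lemma DivergesOn.of_winding {F : ℕ → ℂ → ℂ} {U : Set ℂ} (h : DivergesOn F U)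
    (hF : ∀ n, DifferentiableOn ℂ (F n) {0}ᶜ) (hF0 : ∀ n z, z ≠ 0 → F n z ≠ 0)
    (hw : ∀ ρ : ℝ, ∃ O : Set ℂ, IsOpen O ∧ IsPreconnected O ∧ (∀ w ∈ O, Complex.exp w ∈ U) ∧
      (∀ w ∈ O, ρ < w.re) ∧ ∃ w ∈ O, ∃ k : ℤ, k ≠ 0 ∧ w + k * (2 * Real.pi * I) ∈ O) :
    ∃ r : ℝ, 0 < r ∧ DivergesOn F {z | r < ‖z‖} := by
  obtain ⟨O₀, hO₀, hc₀, hU₀, hρ₀, w₀, hw₀, k₀, hk₀, hw₀'⟩ := hw 0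
  obtain ⟨N₀, R, hN₀, hNc₀, hv₀, hv₀', hR, hM₀⟩ := h.exists_lift hO₀ hc₀ hU₀ hρ₀ hw₀ hw₀'
  refine ⟨Real.exp R, Real.exp_pos R, fun z hz => ?_⟩
  obtain ⟨O₁, hO₁, hc₁, hU₁, hρ₁, w₁, hw₁, k₁, hk₁, hw₁'⟩ := hw (Real.log (‖z‖ + 1))
  obtain ⟨N₁, R₁, hN₁, hNc₁, hv₁, hv₁', hR₁, hM₁⟩ := h.exists_lift hO₁ hc₁ hU₁ hρ₁ hw₁ hw₁'
  have hz0 : 0 < ‖z‖ := (Real.exp_pos R).trans hz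
  refine ⟨{y | Real.exp R < ‖y‖ ∧ ‖y‖ < ‖z‖ + 1},
    ((isOpen_lt continuous_const continuous_norm).inter
      (isOpen_lt continuous_norm continuous_const)).mem_nhds
        ⟨hz, show ‖z‖ < ‖z‖ + 1 from lt_add_one _⟩, fun M => ?_⟩
  filter_upwards [hM₀ (|M| + 1), hM₁ (|M| + 1)] with n h₀ h₁ y hy
  by_contra! hcon
  have hy0 : y ≠ 0 := norm_pos_iff.1 ((Real.exp_pos R).trans hy.1)
  have hre : (Complex.log y).re = Real.log ‖y‖ := Complex.log_re y
  have hyn : 0 < ‖y‖ := norm_pos_iff.2 hy0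
  refine ne_one_of_winding hN₀ hNc₀ hN₁ hNc₁ hk₀ hk₁ hv₀ hv₀' hv₁ hv₁' (q := Complex.log y)
    (fun w hw => ?_) (fun w hw => ?_) (P := fun z => F n y / F n z)
    (DifferentiableOn.div (differentiableOn_const _) (hF n) (hF0 n))
    (c := |M| / (|M| + 1)) ?_ (fun w hw => ?_) ?_
  · rw [hre]
    exact (hR w hw).2.trans ((Real.lt_log_iff_exp_lt hyn).2 hy.1)
  · rw [hre]
    exact (Real.log_lt_log hyn hy.2).trans (hR₁ w hw).1
  · rw [div_lt_one (by positivity)]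
    exact lt_add_one _
  · rw [norm_div]
    have h2 : |M| + 1 < ‖F n (Complex.exp w)‖ := hw.elim (h₀ w) (h₁ w)
    gcongr
    exact hcon.trans (le_abs_self M)
  · rw [Complex.exp_log hy0]
    exact div_self (hF0 n y hy0)

lemma hullConvex_of_divergesOn {G : ℕ → ℂ → ℂ} (hG : ∀ n, Differentiable ℂ (G n)) (ρ : ℝ) :
    HullConvex {w | DivergesOn (fun n w => Complex.exp (G n w)) {w} ∧ ∀ n, ρ < (G n w).re} := by
  intro X hX hXc p hp
  rcases X.eq_empty_or_nonempty with rfl | hne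
  · have := hp (fun _ => 1) (differentiable_const _) 0 (by simp)
    norm_num at this
  constructor
  · refine fun q hq => ?_
    obtain rfl : q = p := hq
    have hdiv : DivergesOn (fun n w => Complex.exp (G n w)) X := fun w hw => (hX hw).1 w rfl
    obtain ⟨V, hV, hXV, hVM⟩ := hdiv.exists_open hXc
    obtain ⟨ε, hε, hεV⟩ := hXc.exists_thickening_subset_open hV hXV
    refine ⟨_, Metric.ball_mem_nhds _ hε, fun M => ?_⟩
    filter_upwards [hVM (|M| + 1)] with n hn y hy
    have h1 := hp (fun z => Complex.exp (-G n (z + (y - q))))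
      ((((hG n).comp (differentiable_id.add_const (y - q))).neg).cexp) (|M| + 1)⁻¹
      (fun z hz => by
        have hzV : z + (y - q) ∈ V := hεV (Metric.mem_thickening_iff.2 ⟨z, hz, by
          simpa [dist_eq_norm] using hy⟩)
        rw [Complex.exp_neg, norm_inv]
        exact inv_anti₀ (by positivity) (hn _ hzV).le)
    simp only [add_sub_cancel] at h1
    rw [Complex.exp_neg, norm_inv] at h1
    have h2 := (inv_le_inv₀ (norm_pos_iff.2 (Complex.exp_ne_zero _)) (by positivity)).1 h1
    linarith [le_abs_self M]
  · intro n
    obtain ⟨x, hx, hmin⟩ := hXc.exists_isMinOn hne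
      (Complex.continuous_re.comp (hG n).continuous).continuousOn
    have h1 := hp (fun z => Complex.exp (-G n z)) (hG n).neg.cexp (Real.exp (-(G n x).re))
      (fun z hz => by
        rw [Complex.norm_exp, Complex.neg_re]
        exact Real.exp_le_exp.2 (neg_le_neg (hmin hz)))
    rw [Complex.norm_exp, Complex.neg_re, Real.exp_le_exp, neg_le_neg_iff] at h1
    exact ((hX hx).2 n).trans_le h1

/-- The exponential function maps components of the preimage of `B` onto components of `B`. -/
lemma exp_image_connectedComponentIn {B : Set ℂ} (hB : IsOpen B) (hB0 : (0 : ℂ) ∉ B) {w : ℂ}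
    (hw : Complex.exp w ∈ B) :
    Complex.exp '' connectedComponentIn (Complex.exp ⁻¹' B) w =
      connectedComponentIn B (Complex.exp w) := by
  have hA : IsOpen (Complex.exp ⁻¹' B) := hB.preimage Complex.continuous_exp
  have hsub := connectedComponentIn_subset (Complex.exp ⁻¹' B) w
  have hwO := mem_connectedComponentIn (F := Complex.exp ⁻¹' B) hw
  refine Subset.antisymm ?_ ?_
  · exact (isPreconnected_connectedComponentIn.image _
      Complex.continuous_exp.continuousOn).subset_connectedComponentIn (mem_image_of_mem _ hwO)
      (image_subset_iff.2 hsub)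
  · have key : ∀ z ∈ B, z ∈ closure (Complex.exp '' connectedComponentIn (Complex.exp ⁻¹' B) w) →
        Complex.exp '' connectedComponentIn (Complex.exp ⁻¹' B) w ∈ 𝓝 z := by
      intro z hz hcl
      obtain ⟨ε, hε, hball⟩ := Metric.isOpen_iff.1 hB z hz
      obtain ⟨L, hL, hLe⟩ := exists_log_on_ball (differentiableOn_id (s := Metric.ball z ε))
        (fun y hy => ne_of_mem_of_not_mem (hball hy) hB0)
      obtain ⟨_, hs, v, hv, rfl⟩ := mem_closure_iff.1 hcl _ Metric.isOpen_ball
        (Metric.mem_ball_self hε)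
      obtain ⟨k, hk⟩ := Complex.exp_eq_exp_iff_exists_int.1 (hLe _ hs)
      simp only [id] at hLe
      have hexp : ∀ y ∈ Metric.ball z ε, Complex.exp (L y + k * (2 * Real.pi * I)) = y := by
        intro y hy
        rw [exp_add_int_mul_two_pi_mul_I, ← hLe y hy]
      have himg : (fun y => L y + k * (2 * Real.pi * I)) '' Metric.ball z ε ⊆
          connectedComponentIn (Complex.exp ⁻¹' B) w := by
        rw [connectedComponentIn_eq hv]
        refine ((convex_ball z ε).isPreconnected.image _
          (hL.continuousOn.add continuousOn_const)).subset_connectedComponentIn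
          ⟨_, hs, hk.symm⟩ ?_
        rintro _ ⟨y, hy, rfl⟩
        exact mem_preimage.2 ((hexp y hy).symm ▸ hball hy)
      filter_upwards [Metric.ball_mem_nhds z hε] with y hy
      exact ⟨_, himg (mem_image_of_mem _ hy), hexp y hy⟩
    have hopen : IsOpen (Complex.exp '' connectedComponentIn (Complex.exp ⁻¹' B) w) := by
      rw [isOpen_iff_mem_nhds]
      rintro _ ⟨v, hv, rfl⟩
      exact key _ (hsub hv) (subset_closure (mem_image_of_mem _ hv))
    refine isPreconnected_connectedComponentIn.subset_of_closure_inter_subset hopen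
      ⟨_, mem_connectedComponentIn hw, mem_image_of_mem _ hwO⟩ ?_
    rintro z ⟨hz, hzB⟩
    exact mem_of_mem_nhds (key z (connectedComponentIn_subset _ _ hzB) hz)

lemma chordalDist_comm (a b : ℂ) : chordalDist a b = chordalDist b a := by
  rw [chordalDist, chordalDist, norm_sub_rev, mul_comm]

lemma chordalDist_le_norm_sub (a b : ℂ) : chordalDist a b ≤ ‖a - b‖ := by
  refine div_le_self (norm_nonneg _) (Real.one_le_sqrt.2 ?_)
  nlinarith [sq_nonneg ‖a‖, sq_nonneg ‖b‖, mul_nonneg (sq_nonneg ‖a‖) (sq_nonneg ‖b‖)]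

lemma norm_sub_le_mul_chordalDist (a b : ℂ) :
    ‖a - b‖ ≤ chordalDist a b * ((1 + ‖a‖) * (1 + ‖b‖)) := by
  have ha := norm_nonneg a
  have hb := norm_nonneg b
  have h0 : 0 < Real.sqrt ((1 + ‖a‖ ^ 2) * (1 + ‖b‖ ^ 2)) := by positivity
  have h1 : Real.sqrt ((1 + ‖a‖ ^ 2) * (1 + ‖b‖ ^ 2)) ≤ (1 + ‖a‖) * (1 + ‖b‖) := by
    refine Real.sqrt_le_iff.2 ⟨by positivity, ?_⟩
    rw [mul_pow]
    gcongr <;> nlinarith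
  calc ‖a - b‖ = chordalDist a b * Real.sqrt ((1 + ‖a‖ ^ 2) * (1 + ‖b‖ ^ 2)) := by
        rw [chordalDist, div_mul_cancel₀ _ h0.ne']
    _ ≤ _ := mul_le_mul_of_nonneg_left h1 (div_nonneg (norm_nonneg _) h0.le)

lemma chordalDist_inv {a b : ℂ} (ha : a ≠ 0) (hb : b ≠ 0) :
    chordalDist a⁻¹ b⁻¹ = chordalDist a b := by
  have ha' := norm_pos_iff.2 ha
  have hb' := norm_pos_iff.2 hb
  have h1 : a⁻¹ - b⁻¹ = (b - a) / (a * b) := by field_simp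
  have h2 : (1 + ‖a⁻¹‖ ^ 2) * (1 + ‖b⁻¹‖ ^ 2) =
      ((1 + ‖a‖ ^ 2) * (1 + ‖b‖ ^ 2)) / (‖a‖ * ‖b‖) ^ 2 := by
    rw [norm_inv, norm_inv]
    field_simp
    ring
  rw [chordalDist, chordalDist, h1, h2, Real.sqrt_div (by positivity),
    Real.sqrt_sq (by positivity), norm_div, norm_mul, norm_sub_rev,
    div_div_div_cancel_right₀ (by positivity)]

lemma chordalDist_le_of_lt {a b : ℂ} {M : ℝ} (hM : 0 < M) (ha : M < ‖a‖) (hb : M < ‖b‖) :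
    chordalDist a b ≤ 2 / M := by
  have ha0 : 0 < ‖a‖ := hM.trans ha
  have hb0 : 0 < ‖b‖ := hM.trans hb
  rw [← chordalDist_inv (norm_pos_iff.1 ha0) (norm_pos_iff.1 hb0)]
  refine (chordalDist_le_norm_sub _ _).trans ((norm_sub_le _ _).trans ?_)
  rw [norm_inv, norm_inv]
  have h1 := inv_anti₀ hM ha.le
  have h2 := inv_anti₀ hM hb.le
  rw [div_eq_mul_inv]
  linarith

lemma lt_norm_of_chordalDist_lt {a b : ℂ} {M : ℝ} (hM : 0 ≤ M) (ha : 2 * M + 1 ≤ ‖a‖)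
    (h : chordalDist a b < 1 / (4 * (1 + M))) : M < ‖b‖ := by
  by_contra! hb
  have h1 := norm_sub_le_mul_chordalDist a b
  have h2 := norm_sub_norm_le a b
  have h3 : chordalDist a b * ((1 + ‖a‖) * (1 + ‖b‖)) <
      1 / (4 * (1 + M)) * ((1 + ‖a‖) * (1 + ‖b‖)) := by
    have := norm_nonneg b
    gcongr
  have h4 : 1 / (4 * (1 + M)) * ((1 + ‖a‖) * (1 + ‖b‖)) ≤
      1 / (4 * (1 + M)) * ((2 * ‖a‖) * (1 + M)) := by
    have := norm_nonneg b
    gcongr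
    linarith
  have h5 : 1 / (4 * (1 + M)) * ((2 * ‖a‖) * (1 + M)) = ‖a‖ / 2 := by
    field_simp
    ring
  linarith

/-- The family `F` is equicontinuous on `W` for the chordal metric. -/
def ChordalEquicontinuousOn (F : ℕ → ℂ → ℂ) (W : Set ℂ) : Prop :=
  ∀ w ∈ W, ∀ ε : ℝ, 0 < ε → ∃ δ : ℝ, 0 < δ ∧ ∀ w' ∈ W,
    chordalDist w w' < δ → ∀ n : ℕ, chordalDist (F n w) (F n w') < ε

lemma DivergesOn.exists_chordalEquicontinuousOn {F : ℕ → ℂ → ℂ}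
    (hF : ∀ n, ContinuousOn (F n) {0}ᶜ) {z : ℂ} (hz : z ≠ 0) (h : DivergesOn F {z}) :
    ∃ W, IsOpen W ∧ z ∈ W ∧ (∀ w ∈ W, w ≠ 0) ∧ ChordalEquicontinuousOn F W := by
  obtain ⟨V, hV, hVM⟩ := h z rfl
  refine ⟨interior V ∩ {0}ᶜ ∩ Metric.ball 0 (‖z‖ + 1),
    (isOpen_interior.inter isOpen_compl_singleton).inter Metric.isOpen_ball,
    ⟨⟨mem_of_mem_nhds (interior_mem_nhds.2 hV), hz⟩, by simp⟩, fun w hw => hw.1.2, ?_⟩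
  rintro w ⟨⟨hwV, hw0⟩, hwb⟩ ε hε
  obtain ⟨N, hN⟩ := eventually_atTop.1 (hVM (4 / ε))
  have hcont : ∀ᶠ w' in 𝓝 w, ∀ n ∈ Finset.range N, dist (F n w') (F n w) < ε := by
    rw [Filter.eventually_all_finset]
    intro n _
    exact Metric.tendsto_nhds.1 ((hF n).continuousAt (isOpen_compl_singleton.mem_nhds hw0)) ε hε
  obtain ⟨η, hη, hball⟩ := Metric.eventually_nhds_iff.1 hcont
  have hC : 0 < (1 + ‖w‖) * (2 + ‖z‖) := by positivity
  refine ⟨η / ((1 + ‖w‖) * (2 + ‖z‖)), by positivity, ?_⟩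
  rintro w' ⟨⟨hwV', hw0'⟩, hwb'⟩ hd n
  rcases lt_or_ge n N with hn | hn
  · refine (chordalDist_le_norm_sub _ _).trans_lt ?_
    rw [← dist_eq_norm, dist_comm]
    refine hball ?_ n (Finset.mem_range.2 hn)
    rw [dist_comm, dist_eq_norm]
    rw [lt_div_iff₀ hC] at hd
    refine lt_of_le_of_lt ((norm_sub_le_mul_chordalDist w w').trans ?_) hd
    rw [mem_ball_zero_iff] at hwb'
    have : 0 ≤ chordalDist w w' := div_nonneg (norm_nonneg _) (Real.sqrt_nonneg _)
    exact mul_le_mul_of_nonneg_left (mul_le_mul_of_nonneg_left (by linarith) (by positivity)) this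
  · refine (chordalDist_le_of_lt (by positivity) (hN n hn w (interior_subset hwV))
      (hN n hn w' (interior_subset hwV'))).trans_lt ?_
    rw [div_div_eq_mul_div]
    linarith

lemma ChordalEquicontinuousOn.divergesOn {F : ℕ → ℂ → ℂ} {W : Set ℂ}
    (h : ChordalEquicontinuousOn F W) (hW : IsOpen W)
    (hF : ∀ w ∈ W, Tendsto (fun n => ‖F n w‖) atTop atTop) : DivergesOn F W := by
  intro z hz
  obtain ⟨ε, hε, hball⟩ := Metric.nhds_basis_closedBall.mem_iff.1 (hW.mem_nhds hz)
  refine ⟨Metric.closedBall z ε, Metric.closedBall_mem_nhds z hε, fun M => ?_⟩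
  refine (isCompact_closedBall z ε).induction_on
    (p := fun s => ∀ᶠ n in atTop, ∀ y ∈ s, M < ‖F n y‖) (by simp) ?_ ?_ ?_
  · intro s t hst ht
    filter_upwards [ht] with n hn y hy using hn y (hst hy)
  · intro s t hs ht
    filter_upwards [hs, ht] with n h1 h2 y hy using hy.elim (h1 y) (h2 y)
  · intro w hw
    obtain ⟨δ, hδ, hd⟩ := h w (hball hw) (1 / (4 * (1 + |M|))) (by positivity)
    refine ⟨Metric.closedBall z ε ∩ Metric.ball w δ,
      inter_mem_nhdsWithin _ (Metric.ball_mem_nhds w hδ), ?_⟩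
    filter_upwards [(hF w (hball hw)).eventually_ge_atTop (2 * |M| + 1)] with n hn y hy
    refine (le_abs_self M).trans_lt (lt_norm_of_chordalDist_lt (abs_nonneg M) hn
      (hd y (hball hy.1) ?_ n))
    refine (chordalDist_le_norm_sub w y).trans_lt ?_
    rw [← dist_eq_norm, dist_comm]
    exact hy.2

lemma isOpen_fatouSet (f : ℂ → ℂ) : IsOpen (FatouSet f) := by
  rw [isOpen_iff_mem_nhds]
  rintro z ⟨-, W, hW, hzW, hW0, h⟩
  filter_upwards [hW.mem_nhds hzW] with w hw
  exact ⟨hW0 w hw, W, hW, hw, hW0, h⟩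

/-- On an invariant Baker domain the iterates tend to infinity or to zero. -/
lemma tendsto_norm_of_invariant {f : ℂ → ℂ} {U : Set ℂ} (hUf : U ⊆ FatouSet f) (hU : IsOpen U)
    (hc : IsPreconnected U) (hinv : f '' U ⊆ U) (hUI : U ⊆ escapingSet f) :
    (∀ w ∈ U, Tendsto (fun n => ‖f^[n] w‖) atTop atTop) ∨
      ∀ w ∈ U, Tendsto (fun n => ‖(f^[n] w)⁻¹‖) atTop atTop := by
  have hesc : ∀ w ∈ U, ∀ M : ℝ, 0 < M → ∀ᶠ n in atTop, ‖f^[n] w‖ < M⁻¹ ∨ M < ‖f^[n] w‖ := by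
    intro w hw M hM
    obtain ⟨N, hN⟩ := (hUI hw).2 M⁻¹ (inv_pos.2 hM)
    filter_upwards [eventually_ge_atTop N] with n hn
    simpa using hN n hn
  have hdir : ∀ x ∈ U, ∀ y : ℂ, (∀ n, chordalDist (f^[n] x) (f^[n] y) < 1 / (4 * (1 + 1))) →
      ∀ᶠ n in atTop, 1 < ‖f^[n] x‖ → 1 < ‖f^[n] y‖ := by
    intro x hx y hxy
    filter_upwards [hesc x hx 3 (by norm_num)] with n hn h1
    refine lt_norm_of_chordalDist_lt zero_le_one ?_ (hxy n)
    rcases hn with hn | hn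
    · norm_num at hn
      linarith
    · linarith
  have hagree : ∀ x ∈ U, ∀ y ∈ U, ∀ᶠ n in atTop, 1 < ‖f^[n] x‖ ↔ 1 < ‖f^[n] y‖ := by
    intro x hx y hy
    refine hc.induction₂ (fun x y => ∀ᶠ n in atTop, 1 < ‖f^[n] x‖ ↔ 1 < ‖f^[n] y‖) ?_ ?_ ?_ hx hy
    · intro x hx
      obtain ⟨-, W, hW, hxW, -, h⟩ := hUf hx
      obtain ⟨δ, hδ, hd⟩ := h x hxW (1 / (4 * (1 + 1))) (by norm_num)
      filter_upwards [mem_nhdsWithin_of_mem_nhds (hW.mem_nhds hxW),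
        mem_nhdsWithin_of_mem_nhds (Metric.ball_mem_nhds x hδ), self_mem_nhdsWithin]
        with y hyW hyδ hyU
      have hxy := hd y hyW ((chordalDist_le_norm_sub x y).trans_lt (by
        rw [← dist_eq_norm, dist_comm]; exact hyδ))
      filter_upwards [hdir x hx y hxy, hdir y hyU x fun n => by
        rw [chordalDist_comm]; exact hxy n] with n h1 h2 using ⟨h1, h2⟩
    · intro x y z _ _ _ hxy hyz
      filter_upwards [hxy, hyz] with n h1 h2 using h1.trans h2
    · intro x y _ _ hxy
      filter_upwards [hxy] with n h1 using h1.symm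
  rcases U.eq_empty_or_nonempty with rfl | ⟨z, hz⟩
  · simp
  obtain ⟨N, hN⟩ := eventually_atTop.1 (hagree z hz (f z) (hinv (mem_image_of_mem f hz)))
  have hstep : ∀ n ≥ N, (1 < ‖f^[N] z‖ ↔ 1 < ‖f^[n] z‖) := by
    intro n hn
    induction n, hn using Nat.le_induction with
    | base => rfl
    | succ n hn ih =>
      rw [ih, hN n hn, ← Function.iterate_succ_apply]
  by_cases h1 : 1 < ‖f^[N] z‖
  · left
    intro w hw
    refine tendsto_atTop.2 fun M => ?_
    filter_upwards [hesc w hw (|M| + 1) (by positivity), hagree z hz w hw,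
      eventually_ge_atTop N] with n hn hzw hnN
    have h2 := hzw.1 ((hstep n hnN).1 h1)
    rcases hn with hn | hn
    · have : (|M| + 1)⁻¹ ≤ 1 := inv_le_one_of_one_le₀ (by linarith [abs_nonneg M])
      linarith
    · linarith [le_abs_self M]
  · right
    intro w hw
    refine tendsto_atTop.2 fun M => ?_
    filter_upwards [hesc w hw (|M| + 1) (by positivity), hagree z hz w hw,
      eventually_ge_atTop N] with n hn hzw hnN
    have h2 : ¬ 1 < ‖f^[n] w‖ := fun h => h1 ((hstep n hnN).2 (hzw.2 h))
    have h0 : 0 < ‖f^[n] w‖ :=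
      norm_pos_iff.2 (hUI ((mapsTo_iff_image_subset.2 hinv).iterate n hw)).1
    rcases hn with hn | hn
    · have h3 := inv_anti₀ h0 hn.le
      rw [inv_inv] at h3
      rw [norm_inv]
      linarith [le_abs_self M]
    · linarith [abs_nonneg M]

lemma simplyConnectedSpace_of_hullConvex {O : Set ℂ} (hO : IsOpen O) (hc : IsPreconnected O)
    (hconv : HullConvex O) (hne : O.Nonempty) {ρ : ℝ} (hρ : ∀ z ∈ O, ρ < z.re) :
    SimplyConnectedSpace O := by
  obtain ⟨f, hf, hinj, himg⟩ := exists_riemann_map hO hc hconv hne hρ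
  obtain ⟨e⟩ := nonempty_homeomorph_image hO hc hf hinj
  have : ContractibleSpace (f '' O) := by
    rw [himg]
    exact (convex_ball 0 1).contractibleSpace ⟨0, by simp⟩
  have := e.contractibleSpace
  infer_instance

/-- A domain which is invariant under a holomorphic self-map `f` of the punctured plane, on which
the iterates tend to infinity, and which is maximal with this property, contains a simply connected
absorbing set. -/
theorem exists_simply_connected_absorbing_of_divergesOn {f g h : ℂ → ℂ} {m : ℤ}
    (hg : Differentiable ℂ g) (hh : Differentiable ℂ h) (hgc : ¬ ∃ c : ℂ, ∀ z, g z = c)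
    (hf : ∀ z : ℂ, z ≠ 0 → f z = z ^ m * Complex.exp (g z + h z⁻¹)) {U : Set ℂ} (hU : IsOpen U)
    (hU0 : U ⊆ {0}ᶜ) (hUc : IsConnected U) (hinv : MapsTo f U U) (hdiv : DivergesOn (fun n => f^[n]) U)
    (hmax : ∀ N : Set ℂ, IsOpen N → IsPreconnected N → (N ∩ U).Nonempty → (0 : ℂ) ∉ N →
      DivergesOn (fun n => f^[n]) N → N ⊆ U) :
    ∃ H : Set ℂ, H ⊆ U ∧ SimplyConnectedSpace H ∧ MapsTo f H H ∧
      ∀ K : Set ℂ, K ⊆ U → IsCompact K → ∃ n : ℕ, f^[n] '' K ⊆ H := by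
  have hf0 : MapsTo f {0}ᶜ {0}ᶜ := fun z hz => by
    rw [hf z hz]
    exact mul_ne_zero (zpow_ne_zero _ hz) (Complex.exp_ne_zero _)
  have hfd : DifferentiableOn ℂ f {0}ᶜ := by
    refine DifferentiableOn.congr (f := fun z => z ^ m * Complex.exp (g z + h z⁻¹))
      (fun z hz => ?_) hf
    have hz0 : z ≠ 0 := hz
    exact ((differentiableAt_zpow.2 (Or.inl hz0)).mul
      ((hg z).add ((hh z⁻¹).fun_comp' z (differentiableAt_inv hz0))).cexp).differentiableWithinAt
  have hfn : ∀ n, DifferentiableOn ℂ f^[n] {0}ᶜ := fun n => hfd.iterate hf0 n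
  let G : ℂ → ℂ := fun w => m * w + g (Complex.exp w) + h (Complex.exp (-w))
  have hGd : Differentiable ℂ G := by fun_prop
  have hGf : Function.Semiconj Complex.exp G f := fun w => by
    rw [hf _ (Complex.exp_ne_zero w), ← Complex.exp_int_mul, ← Complex.exp_neg,
      ← Complex.exp_add, ← add_assoc]
  have hGn : ∀ n w, Complex.exp (G^[n] w) = f^[n] (Complex.exp w) := fun n w =>
    hGf.iterate_right n w
  have hnofix : ∀ z, DivergesOn (fun n => f^[n]) {z} → f z ≠ z := by
    intro z hz hfz
    obtain ⟨V, hV, hVM⟩ := hz z rfl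
    obtain ⟨n, hn⟩ := (hVM ‖z‖).exists
    have := hn z (mem_of_mem_nhds hV)
    simp [Function.iterate_fixed hfz] at this
  obtain ⟨ρ, hρ⟩ : ∃ ρ : ℝ, ∀ O : Set ℂ, IsOpen O → IsPreconnected O →
      (∀ w ∈ O, Complex.exp w ∈ U) → (∀ w ∈ O, ρ < w.re) → InjOn Complex.exp O := by
    by_contra! hcon
    obtain ⟨r, hr, hrd⟩ := hdiv.of_winding hfn (fun n z hz => hf0.iterate n hz) fun ρ => by
      obtain ⟨O, hO, hc, hOU, hOρ, hinj⟩ := hcon ρ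
      simp only [InjOn, not_forall] at hinj
      obtain ⟨v, hv, w, hw, hvw, hne⟩ := hinj
      obtain ⟨k, rfl⟩ := Complex.exp_eq_exp_iff_exists_int.1 hvw
      refine ⟨O, hO, hc, hOU, hOρ, w, hw, k, ?_, hv⟩
      rintro rfl
      simp at hne
    refine hgc (eq_const_of_no_fixed_points (ρ₀ := Real.log r) hg hh (fun _ => rfl : ∀ w, G w = _)
      fun w hw k hk => ?_)
    refine hnofix (Complex.exp w) (hrd.mono (singleton_subset_iff.2 ?_)) ?_
    · rw [mem_ofPred_eq, Complex.norm_exp]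
      exact (Real.log_lt_iff_lt_exp hr).1 hw
    · rw [← hGf w, hk, exp_add_int_mul_two_pi_mul_I]
  set B : Set ℂ := {z | DivergesOn (fun n => f^[n]) {z} ∧ ∀ n, Real.exp ρ < ‖f^[n] z‖} with hB
  have hB0 : (0 : ℂ) ∉ B := fun h0 => by
    have := h0.2 0
    simp only [Function.iterate_zero, id, norm_zero] at this
    exact this.not_gt (Real.exp_pos ρ)
  have hBo : IsOpen B := by
    rw [isOpen_iff_mem_nhds]
    intro z hz
    obtain ⟨V, hV, hVM⟩ := hz.1 z rfl
    obtain ⟨N, hN⟩ := eventually_atTop.1 (hVM (Real.exp ρ))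
    have hz0 : z ≠ 0 := ne_of_mem_of_not_mem hz hB0
    have hcont : ∀ᶠ y in 𝓝 z, ∀ n ∈ Finset.range N, Real.exp ρ < ‖f^[n] y‖ := by
      rw [Filter.eventually_all_finset]
      intro n _
      exact ((hfn n).continuousOn.continuousAt
        (isOpen_compl_singleton.mem_nhds hz0)).norm.eventually_const_lt (hz.2 n)
    filter_upwards [hcont, interior_mem_nhds.2 hV] with y hy hyV
    refine ⟨fun x hx => ⟨V, ?_, hVM⟩, fun n => ?_⟩
    · rw [mem_singleton_iff.1 hx]
      exact mem_interior_iff_mem_nhds.1 hyV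
    · rcases lt_or_ge n N with hn | hn
      · exact hy n (Finset.mem_range.2 hn)
      · exact hN n hn y (interior_subset hyV)
  have hpre : Complex.exp ⁻¹' B =
      {w | DivergesOn (fun n w => Complex.exp (G^[n] w)) {w} ∧ ∀ n, ρ < (G^[n] w).re} := by
    ext w
    simp only [hB, mem_preimage, mem_ofPred_eq, ← hGn, Complex.norm_exp, Real.exp_lt_exp]
    refine and_congr_left fun _ => ⟨fun hw => ?_, fun hw => ?_⟩
    · rintro x rfl
      obtain ⟨V, hV, hVM⟩ := hw _ rfl
      refine ⟨_, Complex.continuous_exp.continuousAt hV, fun M => ?_⟩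
      filter_upwards [hVM M] with n hn y hy
      rw [hGn]
      exact hn _ hy
    · rintro x rfl
      obtain ⟨V, hV, hVM⟩ := hw _ rfl
      refine ⟨Complex.exp '' V, ?_, fun M => ?_⟩
      · rw [← (Complex.hasStrictDerivAt_exp w).map_nhds_eq (Complex.exp_ne_zero w)]
        exact image_mem_map hV
      · filter_upwards [hVM M] with n hn
        rintro _ ⟨y, hy, rfl⟩
        rw [← hGn]
        exact hn y hy
  have hmem : ∀ z ∈ U, ∀ n, (∀ k ≥ n, Real.exp ρ < ‖f^[k] z‖) → f^[n] z ∈ B := by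
    intro z hz n hn
    refine ⟨hdiv.mono (singleton_subset_iff.2 (hinv.iterate n hz)), fun k => ?_⟩
    rw [← Function.iterate_add_apply]
    exact hn _ (Nat.le_add_left _ _)
  have hconn : ∀ C ⊆ U, IsPreconnected C → ∀ n, IsPreconnected (f^[n] '' C) := fun C hC hCc n =>
    hCc.image _ ((hfn n).continuousOn.mono (hC.trans hU0))
  have hlarge : ∀ C ⊆ U, IsCompact C → ∃ N, ∀ n ≥ N, f^[n] '' C ⊆ B := by
    intro C hC hCc
    obtain ⟨V, -, hCV, hVM⟩ := (hdiv.mono hC).exists_open hCc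
    obtain ⟨N, hN⟩ := eventually_atTop.1 (hVM (Real.exp ρ))
    exact ⟨N, fun n hn => image_subset_iff.2 fun z hz =>
      hmem z (hC hz) n fun k hk => hN k (hn.trans hk) z (hCV hz)⟩
  obtain ⟨⟨z₀, hz₀⟩, hUp⟩ := hUc
  have hpath := hU.isConnected_iff_isPathConnected.1 ⟨⟨z₀, hz₀⟩, hUp⟩
  have hjoin : ∀ x ∈ U, ∀ y ∈ U, ∃ N, ∀ n ≥ N,
      f^[n] y ∈ connectedComponentIn B (f^[n] x) := by
    intro x hx y hy
    obtain ⟨γ, hγ⟩ := hpath.joinedIn x hx y hy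
    have hγU : range γ ⊆ U := range_subset_iff.2 hγ
    obtain ⟨N, hN⟩ := hlarge _ hγU (isCompact_range γ.continuous)
    refine ⟨N, fun n hn => ?_⟩
    exact (hconn _ hγU (isPreconnected_range γ.continuous) n).subset_connectedComponentIn
      (mem_image_of_mem _ ⟨0, γ.source⟩) (hN n hn)
      (mem_image_of_mem _ ⟨1, γ.target⟩)
  obtain ⟨N, hN⟩ := hjoin z₀ hz₀ (f z₀) (hinv hz₀)
  set ζ := f^[N] z₀ with hζ
  have hζB : ζ ∈ B := by
    by_contra hcon
    have := hN N le_rfl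
    rw [connectedComponentIn_eq_empty hcon] at this
    exact this
  have hζU : ζ ∈ U := hinv.iterate N hz₀
  set H := connectedComponentIn B ζ with hH
  have hHB : H ⊆ B := connectedComponentIn_subset B ζ
  have hζH : ζ ∈ H := mem_connectedComponentIn hζB
  have hHU : H ⊆ U := hmax H hBo.connectedComponentIn isPreconnected_connectedComponentIn
    ⟨ζ, hζH, hζU⟩ (fun h0 => hB0 (hHB h0)) fun z hz => (hHB hz).1 z rfl
  have hHinv : MapsTo f H H := by
    have hfB : f '' H ⊆ B := by
      rintro _ ⟨z, hz, rfl⟩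
      exact hmem z (hHU hz) 1 fun k _ => (hHB hz).2 k
    have hfζ : f ζ ∈ H := by
      have := hN N le_rfl
      rwa [← Function.iterate_succ_apply, Function.iterate_succ_apply'] at this
    rw [mapsTo_iff_image_subset]
    have := (hconn H hHU isPreconnected_connectedComponentIn 1).subset_connectedComponentIn
      (mem_image_of_mem _ hζH) hfB
    rwa [Function.iterate_one, ← connectedComponentIn_eq hfζ] at this
  have hpt : ∀ n, f^[n] ζ ∈ H := fun n => hHinv.iterate n hζH
  refine ⟨H, hHU, ?_, hHinv, fun K hK hKc => ?_⟩
  · obtain ⟨w, hw⟩ : ∃ w, Complex.exp w = ζ :=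
      ⟨_, Complex.exp_log (ne_of_mem_of_not_mem hζB hB0)⟩
    have hwB : Complex.exp w ∈ B := hw ▸ hζB
    set O := connectedComponentIn (Complex.exp ⁻¹' B) w with hOdef
    have hO : IsOpen O := (hBo.preimage Complex.continuous_exp).connectedComponentIn
    have hOc : IsPreconnected O := isPreconnected_connectedComponentIn
    have hOH : Complex.exp '' O = H := by
      rw [exp_image_connectedComponentIn hBo hB0 hwB, hw]
    have hre : ∀ v ∈ Complex.exp ⁻¹' B, ρ < v.re := by
      intro v hv
      rw [hpre] at hv
      exact hv.2 0
    have hOρ : ∀ v ∈ O, ρ < v.re := fun v hv => hre v (connectedComponentIn_subset _ _ hv)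
    have hconv : HullConvex O := by
      refine HullConvex.connectedComponentIn (hBo.preimage Complex.continuous_exp) ?_ ?_ w
      · intro huniv
        exact lt_irrefl ρ (by simpa using hre ρ (huniv ▸ mem_univ _))
      · rw [hpre]
        exact hullConvex_of_divergesOn (fun n => hGd.iterate n) ρ
    have := simplyConnectedSpace_of_hullConvex hO hOc hconv ⟨w, mem_connectedComponentIn hwB⟩ hOρ
    obtain ⟨e⟩ := nonempty_homeomorph_image hO hOc Complex.differentiable_exp.differentiableOn
      (hρ O hO hOc (fun v hv => hHU (hOH ▸ mem_image_of_mem _ hv)) hOρ)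
    rw [hOH] at e
    exact e.symm.toHomotopyEquiv.simplyConnectedSpace
  · have key : ∃ n, ∀ k ≥ n, ∀ z ∈ K, f^[k] z ∈ H := by
      refine hKc.induction_on (p := fun s => ∃ n, ∀ k ≥ n, ∀ z ∈ s, f^[k] z ∈ H)
        ⟨0, by simp⟩ ?_ ?_ ?_
      · rintro s t hst ⟨n, hn⟩
        exact ⟨n, fun k hk z hz => hn k hk z (hst hz)⟩
      · rintro s t ⟨n, hn⟩ ⟨n', hn'⟩
        exact ⟨max n n', fun k hk z hz => hz.elim (hn k (le_of_max_le_left hk) z)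
          (hn' k (le_of_max_le_right hk) z)⟩
      · intro z hz
        obtain ⟨ε, hε, hball⟩ := Metric.nhds_basis_closedBall.mem_iff.1 (hU.mem_nhds (hK hz))
        obtain ⟨n₁, hn₁⟩ := hlarge _ hball (isCompact_closedBall z ε)
        obtain ⟨n₂, hn₂⟩ := hjoin ζ hζU z (hK hz)
        refine ⟨_, mem_nhdsWithin_of_mem_nhds (Metric.closedBall_mem_nhds z hε), max n₁ n₂,
          fun k hk y hy => ?_⟩
        have h1 := (hconn _ hball (convex_closedBall z ε).isPreconnected
          k).subset_connectedComponentIn (mem_image_of_mem _ (Metric.mem_closedBall_self hε.le))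
          (hn₁ k (le_of_max_le_left hk)) (mem_image_of_mem _ hy)
        rwa [← connectedComponentIn_eq (hn₂ k (le_of_max_le_right hk)),
          ← connectedComponentIn_eq (hpt k)] at h1
    obtain ⟨n, hn⟩ := key
    exact ⟨n, image_subset_iff.2 (hn n le_rfl)⟩

/-- The hypotheses of `exists_simply_connected_absorbing_of_divergesOn` hold for a Fatou component
and a family `F` which is chordally isometric to the iterates. -/
lemma divergesOn_and_maximal_of_isFatouComponent {f : ℂ → ℂ} {U : Set ℂ}
    (hU : IsFatouComponent f U) {F : ℕ → ℂ → ℂ} (hF : ∀ n, ContinuousOn (F n) {0}ᶜ)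
    (hFf : ∀ n z w, z ≠ 0 → w ≠ 0 →
      chordalDist (F n z) (F n w) = chordalDist (f^[n] z) (f^[n] w))
    (hlim : ∀ w ∈ U, Tendsto (fun n => ‖F n w‖) atTop atTop) :
    DivergesOn F U ∧ ∀ N : Set ℂ, IsPreconnected N → (N ∩ U).Nonempty → (0 : ℂ) ∉ N →
      DivergesOn F N → N ⊆ U := by
  obtain ⟨z₀, -, rfl⟩ := hU
  have hUo : IsOpen (connectedComponentIn (FatouSet f) z₀) :=
    (isOpen_fatouSet f).connectedComponentIn
  constructor
  · intro z hz
    obtain ⟨-, W, hW, hzW, hW0, h⟩ := connectedComponentIn_subset _ _ hz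
    have hdiv : DivergesOn F (W ∩ connectedComponentIn (FatouSet f) z₀) := by
      refine ChordalEquicontinuousOn.divergesOn (fun w hw ε hε => ?_) (hW.inter hUo)
        fun w hw => hlim w hw.2
      obtain ⟨δ, hδ, hd⟩ := h w hw.1 ε hε
      exact ⟨δ, hδ, fun w' hw' hww' n => hFf n w w' (hW0 w hw.1) (hW0 w' hw'.1) ▸
        hd w' hw'.1 hww' n⟩
    exact hdiv z ⟨hzW, hz⟩
  · rintro N hN ⟨x, hxN, hxU⟩ hN0 hdiv
    rw [connectedComponentIn_eq hxU]
    refine hN.subset_connectedComponentIn hxN fun z hz => ?_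
    have hz0 : z ≠ 0 := ne_of_mem_of_not_mem hz hN0
    obtain ⟨W, hW, hzW, hW0, h⟩ :=
      (hdiv.mono (singleton_subset_iff.2 hz)).exists_chordalEquicontinuousOn hF hz0
    refine ⟨hz0, W, hW, hzW, hW0, fun w hw ε hε => ?_⟩
    obtain ⟨δ, hδ, hd⟩ := h w hw ε hε
    exact ⟨δ, hδ, fun w' hw' hww' n => hFf n w w' (hW0 w hw) (hW0 w' hw') ▸ hd w' hw' hww' n⟩

lemma DivergesOn.comp_inv {F : ℕ → ℂ → ℂ} {N : Set ℂ} (h : DivergesOn F N) :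
    DivergesOn (fun n z => F n z⁻¹) (Inv.inv ⁻¹' N ∩ {0}ᶜ) := by
  rintro z ⟨hz, hz0⟩
  obtain ⟨V, hV, hVM⟩ := h _ hz
  refine ⟨_, (continuousAt_inv₀ hz0).preimage_mem_nhds hV, fun M => ?_⟩
  filter_upwards [hVM M] with n hn y hy using hn _ hy

/-- Every invariant Baker domain of a transcendental self-map of `ℂ*`
contains a simply connected absorbing set. -/
theorem baker_domain_has_simply_connected_absorbing_set (f : ℂ → ℂ)
    (hf : IsTranscendentalSelfMapCStar f) (U : Set ℂ)
    (hU : IsFatouComponent f U) (hinv : f '' U ⊆ U) (hUI : U ⊆ escapingSet f) :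
    ∃ H : Set ℂ, H ⊆ U ∧ SimplyConnectedSpace ↥H ∧ f '' H ⊆ H ∧
      ∀ K : Set ℂ, K ⊆ U → IsCompact K → ∃ n : ℕ, f^[n] '' K ⊆ H := by
  obtain ⟨m, g, h, hg, hh, hgc, hhc, hfm⟩ := hf
  have hUF : U ⊆ FatouSet f := by
    obtain ⟨z, -, rfl⟩ := hU
    exact connectedComponentIn_subset _ _
  have hUo : IsOpen U := by
    obtain ⟨z, -, rfl⟩ := hU
    exact (isOpen_fatouSet f).connectedComponentIn
  have hUc : IsConnected U := by
    obtain ⟨z, hz, rfl⟩ := hU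
    exact isConnected_connectedComponentIn_iff.2 hz
  have hU0 : U ⊆ {0}ᶜ := fun z hz => (hUI hz).1
  have hmaps := mapsTo_iff_image_subset.2 hinv
  have hf0 : MapsTo f {0}ᶜ {0}ᶜ := fun z hz => by
    rw [hfm z hz]
    exact mul_ne_zero (zpow_ne_zero _ hz) (Complex.exp_ne_zero _)
  have hfc : ContinuousOn f {0}ᶜ := by
    refine ContinuousOn.congr (f := fun z => z ^ m * Complex.exp (g z + h z⁻¹)) ?_ hfm
    have h0 : ContinuousOn (fun z : ℂ => z⁻¹) {0}ᶜ := continuousOn_inv₀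
    exact (continuousOn_id.zpow₀ m fun z hz => Or.inl hz).mul
      (hg.continuous.continuousOn.add (hh.continuous.comp_continuousOn h0)).cexp
  have hfn : ∀ n, ContinuousOn f^[n] {0}ᶜ := fun n => hfc.iterate hf0 n
  rcases tendsto_norm_of_invariant hUF hUo hUc.isPreconnected hinv hUI with hlim | hlim
  · obtain ⟨hdiv, hmax⟩ := divergesOn_and_maximal_of_isFatouComponent hU (F := fun n => f^[n]) hfn
      (fun _ _ _ _ _ => rfl) hlim
    obtain ⟨H, hHU, hHs, hHf, hHK⟩ := exists_simply_connected_absorbing_of_divergesOn hg hh hgc hfm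
      hUo hU0 hUc hmaps hdiv fun N _ => hmax N
    exact ⟨H, hHU, hHs, hHf.image_subset, hHK⟩
  · obtain ⟨hdiv, hmax⟩ := divergesOn_and_maximal_of_isFatouComponent hU
      (F := fun n z => (f^[n] z)⁻¹) (fun n => (hfn n).inv₀ fun z hz => hf0.iterate n hz)
      (fun n z w hz hw => chordalDist_inv (hf0.iterate n hz) (hf0.iterate n hw)) hlim
    let f' : ℂ → ℂ := fun z => (f z⁻¹)⁻¹
    have hsemi : ∀ n z, f'^[n] z⁻¹ = (f^[n] z)⁻¹ := fun n z =>
      (Function.Semiconj.iterate_right (f := Inv.inv) (ga := f) (gb := f')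
        (fun x => by simp [f']) n z).symm
    have hpre : Inv.inv ⁻¹' U ⊆ ({0}ᶜ : Set ℂ) := fun z hz => inv_eq_zero.not.1 (hU0 hz)
    have himg : Inv.inv '' U = Inv.inv ⁻¹' U :=
      congrFun (image_eq_preimage_of_inverse inv_inv inv_inv) U
    have hiter : (fun n => f'^[n]) = fun n z => (f^[n] z⁻¹)⁻¹ := by
      ext n z
      rw [← hsemi, inv_inv]
    obtain ⟨H, hHU, hHs, hHf, hHK⟩ := exists_simply_connected_absorbing_of_divergesOn (f := f')
      (g := fun z => -h z) (h := fun z => -g z) (m := m) hh.neg hg.neg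
      (fun ⟨c, hc⟩ => hhc ⟨-c, fun z => by rw [← hc z, neg_neg]⟩)
      (fun z hz => by
        simp only [f']
        rw [hfm _ (inv_ne_zero hz), inv_inv, mul_inv, ← Complex.exp_neg, inv_zpow, inv_inv]
        ring_nf)
      (U := Inv.inv ⁻¹' U)
      (by
        have := continuousOn_inv₀.isOpen_inter_preimage
          (isOpen_compl_singleton (x := (0 : ℂ))) hUo
        rwa [inter_eq_right.2 hpre] at this)
      hpre (himg ▸ hUc.image _ (continuousOn_inv₀.mono hU0))
      (fun z hz => by
        simp only [f', mem_preimage, inv_inv]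
        exact hmaps hz)
      (by
        rw [hiter]
        exact hdiv.comp_inv.mono fun z hz => ⟨hz, hpre hz⟩)
      (fun N _ hN ⟨x, hxN, hxU⟩ hN0 hNdiv z hz => by
        rw [hiter] at hNdiv
        have hN0' : N ⊆ {0}ᶜ := fun y hy => ne_of_mem_of_not_mem hy hN0
        refine hmax (Inv.inv '' N) (hN.image _ (continuousOn_inv₀.mono hN0'))
          ⟨x⁻¹, mem_image_of_mem _ hxN, hxU⟩ ?_ ?_ (mem_image_of_mem _ hz)
        · rintro ⟨y, hy, hy0⟩
          exact hN0' hy (inv_eq_zero.1 hy0)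
        · have := hNdiv.comp_inv
          simp only [inv_inv] at this
          refine this.mono ?_
          rintro _ ⟨y, hy, rfl⟩
          exact ⟨by simpa using hy, inv_ne_zero (hN0' hy)⟩)
    have hH0 : ∀ z ∈ H, z ≠ 0 := fun z hz => hpre (hHU hz)
    let e : Inv.inv ⁻¹' H ≃ₜ H :=
      { toFun := fun x => ⟨(x : ℂ)⁻¹, x.2⟩
        invFun := fun x => ⟨(x : ℂ)⁻¹, by simp⟩
        left_inv := fun x => by simp
        right_inv := fun x => by simp
        continuous_toFun := (continuous_subtype_val.inv₀
          fun x => inv_eq_zero.not.1 (hH0 _ x.2)).subtype_mk _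
        continuous_invFun := (continuous_subtype_val.inv₀ fun x => hH0 _ x.2).subtype_mk
          fun x => by simp }
    refine ⟨Inv.inv ⁻¹' H, fun z hz => by simpa using hHU hz,
      e.toHomotopyEquiv.simplyConnectedSpace, ?_, fun K hK hKc => ?_⟩
    · rintro _ ⟨z, hz, rfl⟩
      simpa [f'] using hHf hz
    · obtain ⟨n, hn⟩ := hHK (Inv.inv '' K)
        (by
          rintro _ ⟨z, hz, rfl⟩
          simpa using hK hz)
        (hKc.image_of_continuousOn (continuousOn_inv₀.mono (hK.trans hU0)))
      refine ⟨n, ?_⟩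
      rintro _ ⟨z, hz, rfl⟩
      simpa [hsemi] using hn (mem_image_of_mem _ (mem_image_of_mem _ hz))
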